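/- Let F ⊂ ℝⁿ be a compact convex set of volume 1, let P be a non-constant polynomial on ℝⁿ of degree at most d, and let M(P) be the unique positive number with Vol{x ∈ F : |P(x)| ≥ M(P)} = 1/e. Let A₊ be the infimum of constants a > 0 such that Vol{x ∈ F : |P(x)| ≥ (aλ)^d M(P)} ≤ e^{−λ} for all λ ≥ 1, and let A₋ be the infimum of constants a > 0 such that Vol{x ∈ F : |P(x)| < (aλ)^{−d} M(P)} ≤ 1/λ for all λ ≥ 1. Then A₊ · A₋ ≤ 4. -/

import Mathlib

open MeasureTheory

lemma Polynomial.Chebyshev.eval_T_le_pow (n : ℕ) {y : ℝ} (hy : 1 ≤ y) :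
    (Polynomial.Chebyshev.T ℝ n).eval y ≤ (2 * y) ^ n := by
  induction n using Nat.twoStepInduction with
  | zero => simp
  | one => simp; linarith
  | more n _ ih =>
    have h := Polynomial.Chebyshev.T_add_two ℝ n
    have h1 := Polynomial.Chebyshev.one_le_eval_T_real n hy
    push_cast at ih ⊢
    rw [h]
    simp only [Polynomial.eval_sub, Polynomial.eval_mul, Polynomial.eval_ofNat, Polynomial.eval_X]
    rw [pow_succ (2 * y) (n + 1)]
    nlinarith [mul_le_mul_of_nonneg_left ih (by linarith : 0 ≤ 2 * y)]

lemma eval_eq_sum_lagrange (p : Polynomial ℝ) {d : ℕ} (hp : p.natDegree ≤ d) {t : ℕ → ℝ}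
    (ht : Set.InjOn t (Finset.range (d + 1))) (b : ℝ) :
    p.eval b = ∑ i ∈ Finset.range (d + 1), p.eval (t i) *
      ∏ j ∈ (Finset.range (d + 1)).erase i, (t i - t j)⁻¹ * (b - t j) := by
  have hlt : p.degree < (Finset.range (d + 1)).card := by
    rw [Finset.card_range]
    refine lt_of_le_of_lt p.degree_le_natDegree ?_
    exact_mod_cast Nat.lt_succ_of_le hp
  conv_lhs => rw [Lagrange.eq_interpolate ht hlt]
  simp [Lagrange.interpolate_apply, Polynomial.eval_finsetSum, Lagrange.basis,
    Polynomial.eval_prod, Lagrange.basisDivisor]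

open Polynomial.Chebyshev in
lemma sum_prod_abs_node_inv (d : ℕ) (y : ℝ) :
    ∑ i ∈ Finset.range (d + 1), ∏ j ∈ (Finset.range (d + 1)).erase i,
      |node d i - node d j|⁻¹ * (y - node d j) = (T ℝ d).eval y := by
  rw [eval_eq_sum_lagrange (T ℝ d) (d := d) (by simp [natDegree_T]) (strictAntiOn_node d).injOn y]
  refine Finset.sum_congr rfl fun i hi => ?_
  have hi' : i ≤ d := by simpa [Nat.lt_succ_iff] using hi
  rw [eval_T_real_node (by simpa using hi'), Finset.prod_mul_distrib, Finset.prod_mul_distrib,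
    ← mul_assoc, Finset.prod_inv_distrib, Finset.prod_inv_distrib, ← Finset.abs_prod]
  congr 1
  have h := zero_lt_prod_node_sub_node hi'
  set q := ∏ j ∈ (Finset.range (d + 1)).erase i, (node d i - node d j)
  rcases neg_one_pow_eq_or ℝ i with h1 | h1 <;> rw [h1] at h ⊢
  · rw [abs_of_pos (by linarith)]; ring
  · rw [abs_of_neg (by linarith)]; ring_nf

lemma abs_measure_inter_Iic_sub_le {e : Set ℝ} (he : volume e ≠ ⊤) (s t : ℝ) :
    |(volume (e ∩ Set.Iic s)).toReal - (volume (e ∩ Set.Iic t)).toReal| ≤ |s - t| := by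
  have key : ∀ s t : ℝ, s ≤ t → (volume (e ∩ Set.Iic s)).toReal ≤ (volume (e ∩ Set.Iic t)).toReal ∧
      (volume (e ∩ Set.Iic t)).toReal ≤ (volume (e ∩ Set.Iic s)).toReal + (t - s) := by
    intro s t hst
    have hf : ∀ r, volume (e ∩ Set.Iic r) ≠ ⊤ := fun r =>
      ne_top_of_le_ne_top he (measure_mono Set.inter_subset_left)
    refine ⟨ENNReal.toReal_mono (hf t) (measure_mono (by gcongr)), ?_⟩
    have h1 : volume (e ∩ Set.Iic t) ≤ volume (e ∩ Set.Iic s) + ENNReal.ofReal (t - s) := by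
      rw [← Real.volume_Ioc]
      refine (measure_mono ?_).trans (measure_union_le _ _)
      rintro x ⟨hx, hxt⟩
      rcases le_or_gt x s with h | h
      · exact Or.inl ⟨hx, h⟩
      · exact Or.inr ⟨h, hxt⟩
    have h2 := ENNReal.toReal_mono (by simp [hf s]) h1
    rwa [ENNReal.toReal_add (hf s) (by simp), ENNReal.toReal_ofReal (by linarith)] at h2
  rcases le_total s t with h | h
  · have := key s t h
    rw [abs_le]; rw [abs_of_nonpos (by linarith)]; constructor <;> linarith
  · have := key t s h
    rw [abs_le]; rw [abs_of_nonneg (by linarith)]; constructor <;> linarith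

lemma exists_mem_measure_inter_Iic_eq {e : Set ℝ} (he : IsCompact e) {s : ℝ} (hs0 : 0 ≤ s)
    (hs : s ≤ (volume e).toReal) (hpos : 0 < (volume e).toReal) :
    ∃ t ∈ e, (volume (e ∩ Set.Iic t)).toReal = s := by
  have hne : e.Nonempty := by
    rw [Set.nonempty_iff_ne_empty]; rintro rfl; simp at hpos
  have hfin := he.measure_lt_top (μ := volume).ne
  have hzero : (volume (e ∩ Set.Iic (sInf e))).toReal = 0 := by
    have : e ∩ Set.Iic (sInf e) ⊆ {sInf e} := fun x hx =>
      le_antisymm hx.2 (csInf_le he.bddBelow hx.1)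
    rw [measure_mono_null this (by simp)]; rfl
  rcases hs0.eq_or_lt with rfl | hs0
  · exact ⟨sInf e, he.sInf_mem hne, hzero⟩
  have htop : e ∩ Set.Iic (sSup e) = e :=
    Set.inter_eq_left.2 fun x hx => le_csSup he.bddAbove hx
  have hcont : Continuous fun t => (volume (e ∩ Set.Iic t)).toReal := by
    refine (LipschitzWith.of_dist_le_mul (K := 1) fun x y => ?_).continuous
    simpa [Real.dist_eq] using abs_measure_inter_Iic_sub_le hfin x y
  obtain ⟨r, -, hr⟩ := intermediate_value_Icc (Real.sInf_le_sSup e he.bddBelow he.bddAbove)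
    hcont.continuousOn (show s ∈ Set.Icc _ _ from ⟨hzero.trans_le hs0.le, by simpa [htop] using hs⟩)
  have hne' : (e ∩ Set.Iic r).Nonempty := by
    rw [Set.nonempty_iff_ne_empty]; intro h; simp only [h] at hr; simp at hr; linarith
  have hc : IsCompact (e ∩ Set.Iic r) := he.inter_right isClosed_Iic
  have hm := hc.sSup_mem hne'
  refine ⟨sSup (e ∩ Set.Iic r), hm.1, ?_⟩
  rw [← hr]
  dsimp only
  congr 2
  ext x
  exact ⟨fun hx => ⟨hx.1, Set.mem_Iic.2 ((Set.mem_Iic.1 hx.2).trans hm.2)⟩, fun hx => ⟨hx.1, le_csSup hc.bddAbove hx⟩⟩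

open Polynomial.Chebyshev in
/-- The Remez inequality at an endpoint of the interval. -/
theorem remez_right_endpoint (p : Polynomial ℝ) {d : ℕ} (hp : p.natDegree ≤ d) {a b : ℝ}
    {e : Set ℝ} (he : IsCompact e) (hsub : e ⊆ Set.Icc a b) (hpos : 0 < (volume e).toReal)
    {m : ℝ} (hm : ∀ t ∈ e, |p.eval t| ≤ m) :
    |p.eval b| ≤ (4 * (b - a) / (volume e).toReal) ^ d * m := by
  set V := (volume e).toReal with hV
  have hfin := he.measure_lt_top (μ := volume).ne
  have hnode : ∀ j, -1 ≤ node d j ∧ node d j ≤ 1 := fun j => node_mem_Icc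
  have hab : a ≤ b := by
    by_contra h
    have : e = ∅ := Set.subset_empty_iff.1 (hsub.trans (by rw [Set.Icc_eq_empty h]))
    simp [hV, this] at hpos
  have hVL : V ≤ b - a := by
    have := ENNReal.toReal_mono (by simp) (measure_mono (μ := volume) hsub)
    rwa [Real.volume_Icc, ENNReal.toReal_ofReal (by linarith)] at this
  choose t hte hts using fun j => exists_mem_measure_inter_Iic_eq he
    (s := V * (1 + node d j) / 2) (by have := hnode j; nlinarith) (by have := hnode j; nlinarith) hpos
  have hm0 : 0 ≤ m := (abs_nonneg _).trans (hm _ (hte 0))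
  have hdist : ∀ i j, V / 2 * |node d i - node d j| ≤ |t i - t j| := by
    intro i j
    have := abs_measure_inter_Iic_sub_le hfin (t i) (t j)
    rw [hts, hts] at this
    refine le_trans (le_of_eq ?_) this
    rw [show V * (1 + node d i) / 2 - V * (1 + node d j) / 2 = V / 2 * (node d i - node d j) by ring,
      abs_mul, abs_of_pos (half_pos hpos)]
  set y := 2 * (b - a) / V - 1 with hy
  have hy1 : 1 ≤ y := by
    have : 1 ≤ (b - a) / V := by rwa [one_le_div hpos]
    rw [hy, mul_div_assoc]; linarith
  have hyV : V * y = 2 * (b - a) - V := by rw [hy]; field_simp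
  have hright : ∀ j, |b - t j| ≤ V / 2 * (y - node d j) := by
    intro j
    have hj := hsub (hte j)
    rw [abs_of_nonneg (by linarith [hj.2])]
    have h0 : (volume (e ∩ Set.Iic a)).toReal = 0 := by
      have : e ∩ Set.Iic a ⊆ {a} := fun x hx => le_antisymm hx.2 (hsub hx.1).1
      rw [measure_mono_null this (by simp)]; rfl
    have := abs_measure_inter_Iic_sub_le hfin (t j) a
    rw [hts, h0, sub_zero, abs_of_nonneg (by linarith [hj.1] : 0 ≤ t j - a)] at this
    have := (le_abs_self _).trans this
    nlinarith
  have hinj : Set.InjOn t (Finset.range (d + 1)) := by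
    intro i hi j hj hij
    have := hdist i j
    rw [hij, sub_self, abs_zero] at this
    have h0 : |node d i - node d j| ≤ 0 := by
      by_contra h; push Not at h; nlinarith [mul_pos (half_pos hpos) h]
    exact (strictAntiOn_node d).injOn hi hj (sub_eq_zero.1 (abs_nonpos_iff.1 h0))
  have hnodeinj : ∀ i ∈ Finset.range (d + 1), ∀ j ∈ (Finset.range (d + 1)).erase i,
      0 < |node d i - node d j| := by
    intro i hi j hj
    rw [abs_pos, sub_ne_zero]
    intro h
    exact (Finset.mem_erase.1 hj).1 ((strictAntiOn_node d).injOn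
      (Finset.mem_coe.2 hi) (Finset.mem_coe.2 (Finset.mem_erase.1 hj).2) h).symm
  calc |p.eval b| = |∑ i ∈ Finset.range (d + 1), p.eval (t i) *
          ∏ j ∈ (Finset.range (d + 1)).erase i, (t i - t j)⁻¹ * (b - t j)| := by
        rw [← eval_eq_sum_lagrange p hp hinj b]
    _ ≤ ∑ i ∈ Finset.range (d + 1), m *
          ∏ j ∈ (Finset.range (d + 1)).erase i, |node d i - node d j|⁻¹ * (y - node d j) := by
        refine (Finset.abs_sum_le_sum_abs _ _).trans (Finset.sum_le_sum fun i hi => ?_)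
        rw [abs_mul, Finset.abs_prod]
        refine mul_le_mul (hm _ (hte i)) ?_ (Finset.prod_nonneg fun _ _ => abs_nonneg _) hm0
        refine Finset.prod_le_prod (fun _ _ => abs_nonneg _) fun j hj => ?_
        rw [abs_mul, abs_inv]
        have h1 := hnodeinj i hi j hj
        have h2 := hdist i j
        have h3 := hright j
        have h4 : 0 < V / 2 * |node d i - node d j| := by positivity
        calc |t i - t j|⁻¹ * |b - t j|
            ≤ (V / 2 * |node d i - node d j|)⁻¹ * (V / 2 * (y - node d j)) := by gcongr
          _ = |node d i - node d j|⁻¹ * (y - node d j) := by field_simp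
    _ = m * (T ℝ d).eval y := by rw [← Finset.mul_sum, sum_prod_abs_node_inv d y]
    _ ≤ m * (4 * (b - a) / V) ^ d := by
        gcongr
        refine (eval_T_le_pow d hy1).trans ?_
        refine pow_le_pow_left₀ (by linarith) ?_ d
        rw [hy, show 4 * (b - a) / V = 2 * (2 * (b - a) / V) by ring]; linarith
    _ = _ := mul_comm _ _

/-- If `|p|` is at least `(4 l)^d m` at `x`, then `{|p| < m}` occupies at most the fraction `1 / l`
of any interval ending at `x`. -/
lemma volume_sublevel_Icc_left_le (p : Polynomial ℝ) {d : ℕ} (hp : p.natDegree ≤ d) {l m : ℝ}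
    (hl : 0 < l) {x : ℝ} (hx : (4 * l) ^ d * m ≤ |p.eval x|) {y : ℝ} (hyx : y ≤ x) :
    volume ({t | |p.eval t| < m} ∩ Set.Icc y x) ≤ ENNReal.ofReal ((x - y) / l) := by
  by_contra! hlt
  have hcont : Continuous fun t => |p.eval t| := p.continuous.abs
  have hopen : IsOpen {t | |p.eval t| < m} := isOpen_lt hcont continuous_const
  obtain ⟨K, hKsub, hK, hKlt⟩ :=
    (hopen.measurableSet.inter measurableSet_Icc).exists_lt_isCompact hlt
  have hKfin := hK.measure_lt_top (μ := volume).ne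
  have hV : (x - y) / l < (volume K).toReal := (ENNReal.ofReal_lt_iff_lt_toReal (by
    have : 0 ≤ x - y := by linarith
    positivity) hKfin).1 hKlt
  have hxy : 0 ≤ (x - y) / l := div_nonneg (by linarith) hl.le
  have hVpos : 0 < (volume K).toReal := by linarith
  have hKne : K.Nonempty := by
    rw [Set.nonempty_iff_ne_empty]; rintro rfl; simp at hVpos
  obtain ⟨t, htK, htmax⟩ := hK.exists_isMaxOn hKne hcont.continuousOn
  have htm : |p.eval t| < m := (hKsub htK).1
  have h := remez_right_endpoint p hp hK (hKsub.trans Set.inter_subset_right) hVpos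
    (m := |p.eval t|) fun s hs => htmax hs
  have h2 : (4 * (x - y) / (volume K).toReal) ^ d ≤ (4 * l) ^ d := by
    refine pow_le_pow_left₀ (div_nonneg (by linarith) hVpos.le) ?_ d
    rw [div_le_iff₀ hVpos]
    rw [div_lt_iff₀ hl] at hV
    nlinarith
  have h3 : |p.eval x| ≤ (4 * l) ^ d * |p.eval t| :=
    h.trans (mul_le_mul_of_nonneg_right h2 (abs_nonneg _))
  have h4 : (4 * l) ^ d * |p.eval t| < (4 * l) ^ d * m := by gcongr
  linarith

lemma volume_sublevel_Icc_right_le (p : Polynomial ℝ) {d : ℕ} (hp : p.natDegree ≤ d) {l m : ℝ}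
    (hl : 0 < l) {x : ℝ} (hx : (4 * l) ^ d * m ≤ |p.eval x|) {y : ℝ} (hxy : x ≤ y) :
    volume ({t | |p.eval t| < m} ∩ Set.Icc x y) ≤ ENNReal.ofReal ((y - x) / l) := by
  have hq : (p.comp (-Polynomial.X)).natDegree ≤ d := by
    rw [Polynomial.natDegree_comp]; simpa using hp
  have h := volume_sublevel_Icc_left_le (p.comp (-Polynomial.X)) hq hl (m := m) (x := -x) (y := -y)
    (by simpa using hx) (by linarith)
  rw [← Measure.measure_neg] at h
  convert h using 2
  · ext t; simp [and_comm]
  · ring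

lemma setLIntegral_inter_le_of_monotoneOn {g : ℝ → ℝ} {c x l : ℝ} (hl : 0 < l)
    (hg : MonotoneOn g (Set.Ioo c x)) (hg0 : ∀ s, 0 ≤ g s) (hgm : Measurable g)
    {A : Set ℝ}
    (hAx : ∀ y ∈ Set.Icc c x, volume (A ∩ Set.Icc y x) ≤ ENNReal.ofReal ((x - y) / l)) :
    ∫⁻ s in A ∩ Set.Ioo c x, ENNReal.ofReal (g s) ≤
      ENNReal.ofReal l⁻¹ * ∫⁻ s in Set.Ioo c x, ENNReal.ofReal (g s) := by
  have hlt : ∀ t, MeasurableSet {s | t < g s} := fun t => measurableSet_lt measurable_const hgm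
  rw [lintegral_eq_lintegral_meas_lt _ (Filter.Eventually.of_forall hg0) hgm.aemeasurable,
    lintegral_eq_lintegral_meas_lt _ (Filter.Eventually.of_forall hg0) hgm.aemeasurable,
    ← lintegral_const_mul' _ _ ENNReal.ofReal_ne_top]
  refine lintegral_mono fun t => ?_
  dsimp only
  rw [Measure.restrict_apply (hlt t), Measure.restrict_apply (hlt t)]
  set U := {s | t < g s} ∩ Set.Ioo c x with hU
  rcases U.eq_empty_or_nonempty with h | hne
  · have : {s | t < g s} ∩ (A ∩ Set.Ioo c x) = ∅ := by
      rw [Set.inter_left_comm, ← hU, h, Set.inter_empty]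
    simp [this]
  have hbdd : BddBelow U := ⟨c, fun s hs => hs.2.1.le⟩
  set y := sInf U with hy
  obtain ⟨s0, hs0⟩ := hne
  have hcy : c ≤ y := le_csInf ⟨s0, hs0⟩ fun s hs => hs.2.1.le
  have hyx : y ≤ x := (csInf_le hbdd hs0).trans hs0.2.2.le
  have hsub : Set.Ioo y x ⊆ U := by
    intro s hs
    obtain ⟨r, hr, hrs⟩ := exists_lt_of_csInf_lt ⟨s0, hs0⟩ hs.1
    have hsI : s ∈ Set.Ioo c x := ⟨hcy.trans_lt hs.1, hs.2⟩
    exact ⟨lt_of_lt_of_le hr.1 (hg hr.2 hsI hrs.le), hsI⟩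
  calc volume ({s | t < g s} ∩ (A ∩ Set.Ioo c x)) ≤ volume (A ∩ Set.Icc y x) := by
        refine measure_mono fun s hs => ⟨hs.2.1, csInf_le hbdd ⟨hs.1, hs.2.2⟩, hs.2.2.2.le⟩
    _ ≤ ENNReal.ofReal ((x - y) / l) := hAx y ⟨hcy, hyx⟩
    _ = ENNReal.ofReal l⁻¹ * volume (Set.Ioo y x) := by
        rw [Real.volume_Ioo, ← ENNReal.ofReal_mul (by positivity)]; congr 1; field_simp
    _ ≤ _ := by gcongr

lemma setIntegral_Ioi_mul_le {w : ℝ → ℝ} (hw : Integrable w)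
    (hlc : ∀ s s' τ, s ≤ s' → 0 ≤ τ → w s * w (s' + τ) ≤ w s' * w (s + τ)) {s s' : ℝ}
    (hs : s ≤ s') : w s * ∫ t in Set.Ioi s', w t ≤ w s' * ∫ t in Set.Ioi s, w t := by
  have hshift : ∀ s : ℝ, ∫ t in Set.Ioi s, w t = ∫ τ in Set.Ioi 0, w (s + τ) := by
    intro s
    have h := (measurePreserving_add_left volume s).setIntegral_preimage_emb
      (measurableEmbedding_addLeft s) w (Set.Ioi s)
    rw [← h, Set.preimage_const_add_Ioi, sub_self]
  rw [hshift, hshift, ← integral_const_mul, ← integral_const_mul]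
  refine setIntegral_mono_on ((hw.comp_add_left s').integrableOn.const_mul _)
    ((hw.comp_add_left s).integrableOn.const_mul _) measurableSet_Ioi fun τ hτ => ?_
  exact hlc s s' τ hs (le_of_lt hτ)

lemma setIntegral_Ioi_antitone {w : ℝ → ℝ} (hw : Integrable w) (h0 : ∀ s, 0 ≤ w s) :
    Antitone fun s => ∫ t in Set.Ioi s, w t := fun _ _ hs =>
  setIntegral_mono_set hw.integrableOn (Filter.Eventually.of_forall h0)
    (Set.Ioi_subset_Ioi hs).eventuallyLE

lemma setLIntegral_hazard_le {w : ℝ → ℝ} (hw : Integrable w) (h0 : ∀ s, 0 ≤ w s) {c x : ℝ}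
    (hcx : c ≤ x) (hx : 0 < ∫ t in Set.Ioi x, w t) :
    ∫⁻ s in Set.Ioo c x, ENNReal.ofReal (w s / ∫ t in Set.Ioi s, w t) ≤
      ENNReal.ofReal (Real.log ((∫ t in Set.Ioi c, w t) / ∫ t in Set.Ioi x, w t)) := by
  set T : ℝ → ℝ := fun s => ∫ t in Set.Ioi s, w t with hT
  have hTanti : Antitone T := setIntegral_Ioi_antitone hw h0
  have hTpos : ∀ s ≤ x, 0 < T s := fun s hs => hx.trans_le (hTanti hs)
  have hderiv : ∀ᵐ s, HasDerivAt T (-w s) s := by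
    filter_upwards [LocallyIntegrable.ae_hasDerivAt_integral hw.locallyIntegrable] with s hs
    have h1 := (hs c).const_sub (T c)
    refine h1.congr_of_eventuallyEq (Filter.Eventually.of_forall fun r => ?_)
    have := intervalIntegral.integral_Ioi_sub_Ioi' (a := c) (b := r) (μ := volume) (f := w)
      hw.integrableOn hw.integrableOn
    simp only [hT]; linarith
  obtain ⟨N, hN, hNm, hN0⟩ := exists_measurable_superset_of_null (ae_iff.1 hderiv)
  set S := Set.Ioo c x \ N with hS
  have hSm : MeasurableSet S := measurableSet_Ioo.diff hNm
  have hSae : (S : Set ℝ) =ᵐ[volume] Set.Ioo c x := sdiff_null_ae_eq_self hN0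
  have hcov := lintegral_image_eq_lintegral_deriv_mul_of_antitoneOn (f := T) (f' := fun s => -w s)
    hSm (fun s hs => by
      have : HasDerivAt T (-w s) s := by
        by_contra h; exact hs.2 (hN h)
      exact this.hasDerivWithinAt) (hTanti.antitoneOn _) (fun t => ENNReal.ofReal t⁻¹)
  rw [← setLIntegral_congr hSae]
  calc ∫⁻ s in S, ENNReal.ofReal (w s / T s)
      = ∫⁻ s in S, ENNReal.ofReal (- -w s) * ENNReal.ofReal (T s)⁻¹ := by
        refine lintegral_congr fun s => ?_
        rw [neg_neg, ← ENNReal.ofReal_mul (h0 s), div_eq_mul_inv]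
    _ = ∫⁻ t in T '' S, ENNReal.ofReal t⁻¹ := hcov.symm
    _ ≤ ∫⁻ t in Set.Icc (T x) (T c), ENNReal.ofReal t⁻¹ := by
        refine lintegral_mono_set ?_
        rintro _ ⟨s, hs, rfl⟩
        exact ⟨hTanti hs.1.2.le, hTanti hs.1.1.le⟩
    _ = ENNReal.ofReal (∫ t in T x..T c, t⁻¹) := by
        rw [intervalIntegral.integral_of_le (hTanti hcx), ← integral_Icc_eq_integral_Ioc,
          ofReal_integral_eq_lintegral_ofReal]
        · refine (ContinuousOn.integrableOn_Icc ?_)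
          exact continuousOn_inv₀.mono fun t ht => (hx.trans_le ht.1).ne'
        · refine (ae_restrict_iff' measurableSet_Icc).2 (Filter.Eventually.of_forall fun t ht => ?_)
          exact inv_nonneg.2 (hx.trans_le ht.1).le
    _ = _ := by rw [integral_inv_of_pos hx (hTpos c hcx)]

/-- A lower-set version of the one-dimensional dilation inequality: if a measurable set `A` has
density at most `1 / l` in every interval `[y, x]`, then its mass in `(c, x)` for a log-concave
weight is controlled by the decay of the tail. -/
lemma setIntegral_inter_Ioo_le_right {w : ℝ → ℝ} (hwm : Measurable w) (hw : Integrable w)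
    (h0 : ∀ s, 0 ≤ w s)
    (hlc : ∀ s s' τ, s ≤ s' → 0 ≤ τ → w s * w (s' + τ) ≤ w s' * w (s + τ))
    {c x l : ℝ} (hl : 0 < l) (hcx : c ≤ x) (hx : 0 < ∫ t in Set.Ioi x, w t)
    {A : Set ℝ} (hA : MeasurableSet A)
    (hAx : ∀ y ∈ Set.Icc c x, volume (A ∩ Set.Icc y x) ≤ ENNReal.ofReal ((x - y) / l)) :
    l * ∫ s in A ∩ Set.Ioo c x, w s ≤
      (∫ t in Set.Ioi c, w t) * Real.log ((∫ t in Set.Ioi c, w t) / ∫ t in Set.Ioi x, w t) := by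
  set T : ℝ → ℝ := fun s => ∫ t in Set.Ioi s, w t with hT
  have hTanti : Antitone T := setIntegral_Ioi_antitone hw h0
  have hT0 : ∀ s, 0 ≤ T s := fun s => setIntegral_nonneg measurableSet_Ioi fun t _ => h0 t
  have hTpos : ∀ s ≤ x, 0 < T s := fun s hs => hx.trans_le (hTanti hs)
  have hmono : MonotoneOn (fun s => w s / T s) (Set.Ioo c x) := by
    intro s hs s' hs' hss
    rw [div_le_div_iff₀ (hTpos s hs.2.le) (hTpos s' hs'.2.le)]
    exact setIntegral_Ioi_mul_le hw hlc hss
  have h1 := setLIntegral_inter_le_of_monotoneOn hl hmono (fun s => div_nonneg (h0 s) (hT0 s))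
    (hwm.div hTanti.measurable) hAx
  have hlog : 0 ≤ Real.log (T c / T x) :=
    Real.log_nonneg ((one_le_div hx).2 (hTanti hcx))
  have h2 : ENNReal.ofReal (∫ s in A ∩ Set.Ioo c x, w s) ≤
      ENNReal.ofReal (T c * (l⁻¹ * Real.log (T c / T x))) := by
    rw [ofReal_integral_eq_lintegral_ofReal hw.integrableOn (Filter.Eventually.of_forall h0)]
    calc ∫⁻ s in A ∩ Set.Ioo c x, ENNReal.ofReal (w s)
        ≤ ∫⁻ s in A ∩ Set.Ioo c x, ENNReal.ofReal (T c) * ENNReal.ofReal (w s / T s) := by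
          refine setLIntegral_mono' (hA.inter measurableSet_Ioo) fun s hs => ?_
          rw [← ENNReal.ofReal_mul (hT0 c)]
          refine ENNReal.ofReal_le_ofReal ?_
          have hTs := hTpos s hs.2.2.le
          rw [mul_div_assoc', le_div_iff₀ hTs, mul_comm]
          exact mul_le_mul_of_nonneg_right (hTanti hs.2.1.le) (h0 s)
      _ = ENNReal.ofReal (T c) * ∫⁻ s in A ∩ Set.Ioo c x, ENNReal.ofReal (w s / T s) :=
          lintegral_const_mul' _ _ ENNReal.ofReal_ne_top
      _ ≤ ENNReal.ofReal (T c) * (ENNReal.ofReal l⁻¹ * ENNReal.ofReal (Real.log (T c / T x))) := by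
          gcongr
          refine h1.trans ?_
          gcongr
          exact setLIntegral_hazard_le hw h0 hcx hx
      _ = _ := by
          rw [ENNReal.ofReal_mul (hT0 c), ENNReal.ofReal_mul (by positivity)]
  have h3 := (ENNReal.ofReal_le_ofReal_iff
    (mul_nonneg (hT0 c) (mul_nonneg (by positivity) hlog))).1 h2
  calc l * ∫ s in A ∩ Set.Ioo c x, w s ≤ l * (T c * (l⁻¹ * Real.log (T c / T x))) := by gcongr
    _ = _ := by field_simp; rfl

lemma setIntegral_inter_Ioo_le_left {w : ℝ → ℝ} (hwm : Measurable w) (hw : Integrable w)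
    (h0 : ∀ s, 0 ≤ w s)
    (hlc : ∀ s s' τ, s ≤ s' → 0 ≤ τ → w s * w (s' + τ) ≤ w s' * w (s + τ))
    {c x l : ℝ} (hl : 0 < l) (hxc : x ≤ c) (hx : 0 < ∫ t in Set.Iic x, w t)
    {A : Set ℝ} (hA : MeasurableSet A)
    (hAx : ∀ y ∈ Set.Icc x c, volume (A ∩ Set.Icc x y) ≤ ENNReal.ofReal ((y - x) / l)) :
    l * ∫ s in A ∩ Set.Ioo x c, w s ≤
      (∫ t in Set.Iic c, w t) * Real.log ((∫ t in Set.Iic c, w t) / ∫ t in Set.Iic x, w t) := by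
  have hneg : MeasurePreserving (fun s : ℝ => -s) := Measure.measurePreserving_neg volume
  have key := setIntegral_inter_Ioo_le_right (w := fun s => w (-s)) (c := -c) (x := -x)
    (A := (fun s => -s) ⁻¹' A) (hwm.comp measurable_neg) hw.comp_neg (fun s => h0 _)
    (fun s s' τ hs hτ => by
      have h := hlc (-s' - τ) (-s - τ) τ (by linarith) hτ
      have e1 : -s - τ + τ = -s := by ring
      have e2 : -s' - τ + τ = -s' := by ring
      have e3 : -(s' + τ) = -s' - τ := by ring
      have e4 : -(s + τ) = -s - τ := by ring
      rw [e1, e2] at h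
      rw [e3, e4]
      linarith) hl (by linarith) (by simpa [integral_comp_neg_Ioi] using hx)
    (hA.preimage measurable_neg) (fun y hy => by
      have h := hAx (-y) ⟨by linarith [hy.2], by linarith [hy.1]⟩
      have e : (fun s : ℝ => -s) ⁻¹' A ∩ Set.Icc y (-x) =
          (fun s : ℝ => -s) ⁻¹' (A ∩ Set.Icc x (-y)) := by
        ext s
        simp only [Set.mem_inter_iff, Set.mem_preimage, Set.mem_Icc]
        constructor
        · rintro ⟨a, b, c⟩; exact ⟨a, by linarith, by linarith⟩
        · rintro ⟨a, b, c⟩; exact ⟨a, by linarith, by linarith⟩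
      rw [e, hneg.measure_preimage (hA.inter measurableSet_Icc).nullMeasurableSet]
      convert h using 3
      ring)
  have e : (fun s : ℝ => -s) ⁻¹' A ∩ Set.Ioo (-c) (-x) =
      (fun s : ℝ => -s) ⁻¹' (A ∩ Set.Ioo x c) := by
    ext s
    simp only [Set.mem_inter_iff, Set.mem_preimage, Set.mem_Ioo]
    constructor
    · rintro ⟨a, b, c⟩; exact ⟨a, by linarith, by linarith⟩
    · rintro ⟨a, b, c⟩; exact ⟨a, by linarith, by linarith⟩
  rw [integral_comp_neg_Ioi, integral_comp_neg_Ioi, neg_neg, neg_neg, e,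
    hneg.setIntegral_preimage_emb (Homeomorph.neg ℝ).measurableEmbedding w] at key
  exact key

/-- The mass in a gap `(x₁, x₂)` of a set `A` that is sparse seen from both endpoints. -/
lemma setIntegral_inter_Ioo_le_neg_log {w : ℝ → ℝ} (hwm : Measurable w) (hw : Integrable w)
    (h0 : ∀ s, 0 ≤ w s)
    (hlc : ∀ s s' τ, s ≤ s' → 0 ≤ τ → w s * w (s' + τ) ≤ w s' * w (s + τ))
    (hw1 : ∫ s, w s = 1) {x₁ x₂ l : ℝ} (hl : 0 < l) (hx : x₁ ≤ x₂)
    (hpos : 0 < (∫ t in Set.Iic x₁, w t) + ∫ t in Set.Ioi x₂, w t)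
    {A : Set ℝ} (hA : MeasurableSet A)
    (hA₁ : (∫ t in Set.Iic x₁, w t) = 0 ∨
      ∀ y, x₁ ≤ y → volume (A ∩ Set.Icc x₁ y) ≤ ENNReal.ofReal ((y - x₁) / l))
    (hA₂ : (∫ t in Set.Ioi x₂, w t) = 0 ∨
      ∀ y, y ≤ x₂ → volume (A ∩ Set.Icc y x₂) ≤ ENNReal.ofReal ((x₂ - y) / l)) :
    l * ∫ s in A ∩ Set.Ioo x₁ x₂, w s ≤
      -Real.log ((∫ t in Set.Iic x₁, w t) + ∫ t in Set.Ioi x₂, w t) := by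
  set g : ℝ → ℝ := fun s => ∫ t in Set.Iic s, w t with hg
  set T : ℝ → ℝ := fun s => ∫ t in Set.Ioi s, w t with hT
  have hgT : ∀ s, g s + T s = 1 := fun s => by
    rw [← hw1]
    exact intervalIntegral.integral_Iic_add_Ioi hw.integrableOn hw.integrableOn
  have hg0 : ∀ s, 0 ≤ g s := fun s => setIntegral_nonneg measurableSet_Iic fun t _ => h0 t
  have hT0 : ∀ s, 0 ≤ T s := fun s => setIntegral_nonneg measurableSet_Ioi fun t _ => h0 t
  have hTanti : Antitone T := setIntegral_Ioi_antitone hw h0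
  have hgc : Continuous g := by
    have : g = fun s => g 0 + ∫ t in (0:ℝ)..s, w t := by
      funext s
      rw [← intervalIntegral.integral_Iic_sub_Iic hw.integrableOn hw.integrableOn]
      simp [hg]
    rw [this]
    exact continuous_const.add (intervalIntegral.continuous_primitive
      (fun a b => hw.intervalIntegrable) 0)
  set a := g x₁ with ha
  set b := T x₂ with hb
  change 0 < a + b at hpos
  change l * _ ≤ -Real.log (a + b)
  have hab1 : a + b ≤ 1 := by
    have := hTanti hx
    linarith [hgT x₁]
  obtain ⟨c, hc, hgcv⟩ : ∃ c ∈ Set.Icc x₁ x₂, g c = a / (a + b) := by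
    refine intermediate_value_Icc hx hgc.continuousOn ⟨?_, ?_⟩
    · rw [le_div_iff₀ hpos]; nlinarith [hg0 x₁]
    · rw [div_le_iff₀ hpos, show g x₂ = 1 - b by linarith [hgT x₂]]; nlinarith [hT0 x₂]
  have hTc : T c = b / (a + b) := by
    have := hgT c
    rw [eq_div_iff hpos.ne']
    rw [eq_div_iff hpos.ne'] at hgcv
    nlinarith
  have hleft : l * ∫ s in A ∩ Set.Ioo x₁ c, w s ≤ g c * -Real.log (a + b) := by
    rcases (hg0 x₁).eq_or_lt with h | h
    · have hgc0 : g c = 0 := by rw [hgcv, ha, ← h, zero_div]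
      have : ∫ s in A ∩ Set.Ioo x₁ c, w s ≤ g c :=
        setIntegral_mono_set hw.integrableOn (Filter.Eventually.of_forall h0)
          (Filter.Eventually.of_forall fun s hs => hs.2.2.le)
      rw [hgc0] at this ⊢
      nlinarith
    · have := setIntegral_inter_Ioo_le_left hwm hw h0 hlc hl hc.1 h hA
        fun y hy => (hA₁.resolve_left h.ne') y hy.1
      change _ ≤ g c * Real.log (g c / a) at this
      rwa [show g c / a = (a + b)⁻¹ by
        change 0 < a at h
        rw [hgcv]; field_simp, Real.log_inv] at this
  have hright : l * ∫ s in A ∩ Set.Ioo c x₂, w s ≤ T c * -Real.log (a + b) := by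
    rcases (hT0 x₂).eq_or_lt with h | h
    · have hTc0 : T c = 0 := by rw [hTc, hb, ← h, zero_div]
      have : ∫ s in A ∩ Set.Ioo c x₂, w s ≤ T c :=
        setIntegral_mono_set hw.integrableOn (Filter.Eventually.of_forall h0)
          (Filter.Eventually.of_forall fun s hs => hs.2.1)
      rw [hTc0] at this ⊢
      nlinarith
    · have := setIntegral_inter_Ioo_le_right hwm hw h0 hlc hl hc.2 h hA
        fun y hy => (hA₂.resolve_left h.ne') y hy.2
      change _ ≤ T c * Real.log (T c / b) at this
      rwa [show T c / b = (a + b)⁻¹ by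
        change 0 < b at h
        rw [hTc]; field_simp, Real.log_inv] at this
  have hsplit : ∫ s in A ∩ Set.Ioo x₁ x₂, w s ≤
      (∫ s in A ∩ Set.Ioo x₁ c, w s) + ∫ s in A ∩ Set.Ioo c x₂, w s := by
    rw [← setIntegral_union _ (hA.inter measurableSet_Ioo) hw.integrableOn hw.integrableOn]
    · refine setIntegral_mono_set hw.integrableOn (Filter.Eventually.of_forall h0) ?_
      have hne : ∀ᵐ s : ℝ, s ≠ c := by simp [ae_iff]
      filter_upwards [hne] with s hs hsA
      rcases lt_or_gt_of_ne hs with h | h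
      · exact Or.inl ⟨hsA.1, hsA.2.1, h⟩
      · exact Or.inr ⟨hsA.1, h, hsA.2.2⟩
    · exact Set.disjoint_left.2 fun s hs hs' => (hs.2.2.trans hs'.2.1).false
  calc l * ∫ s in A ∩ Set.Ioo x₁ x₂, w s
      ≤ l * (∫ s in A ∩ Set.Ioo x₁ c, w s) + l * ∫ s in A ∩ Set.Ioo c x₂, w s := by
        rw [← mul_add]; gcongr
    _ ≤ (g c + T c) * -Real.log (a + b) := by linarith
    _ = _ := by rw [hgT, one_mul]

lemma one_sub_sum_le_prod_one_sub {ι : Type*} (s : Finset ι) (q : ι → ℝ) (h0 : ∀ i, 0 ≤ q i)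
    (h1 : ∀ i ∈ s, q i ≤ 1) : 1 - ∑ i ∈ s, q i ≤ ∏ i ∈ s, (1 - q i) := by
  classical
  induction s using Finset.induction_on with
  | empty => simp
  | insert i s hi ih =>
    rw [Finset.sum_insert hi, Finset.prod_insert hi]
    have hp : ∏ j ∈ s, (1 - q j) ≤ 1 := Finset.prod_le_one
      (fun j hj => sub_nonneg.2 (h1 j (Finset.mem_insert_of_mem hj))) fun j _ => by
        linarith [h0 j]
    have := ih fun j hj => h1 j (Finset.mem_insert_of_mem hj)
    nlinarith [h0 i]

/-- If a closed set `K` sees the set `A` sparsely from each of its points, then the mass of `A`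
for a log-concave probability density is controlled by the mass of `K`. -/
lemma mul_setIntegral_le_neg_log {w : ℝ → ℝ} (hwm : Measurable w) (hw : Integrable w)
    (h0 : ∀ s, 0 ≤ w s)
    (hlc : ∀ s s' τ, s ≤ s' → 0 ≤ τ → w s * w (s' + τ) ≤ w s' * w (s + τ))
    (hw1 : ∫ s, w s = 1) {α β : ℝ} (hsupp : ∀ s, s ∉ Set.Ioo α β → w s = 0)
    {l : ℝ} (hl : 0 < l) {A K : Set ℝ} (hA : MeasurableSet A) (hK : IsClosed K)
    (hAK : Disjoint A K) (hKpos : 0 < ∫ s in K, w s)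
    (hK₁ : ∀ x ∈ K, ∀ y, x ≤ y → volume (A ∩ Set.Icc x y) ≤ ENNReal.ofReal ((y - x) / l))
    (hK₂ : ∀ x ∈ K, ∀ y, y ≤ x → volume (A ∩ Set.Icc y x) ≤ ENNReal.ofReal ((x - y) / l)) :
    l * ∫ s in A, w s ≤ -Real.log (∫ s in K, w s) := by
  have hαβ : α < β := by
    by_contra h
    have : w = 0 := funext fun s => hsupp s (by rw [Set.Ioo_eq_empty h]; simp)
    simp [this] at hw1
  have hzα : ∫ t in Set.Iic α, w t = 0 :=
    setIntegral_eq_zero_of_forall_eq_zero fun t ht => hsupp t fun h => (h.1.trans_le ht).false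
  have hzβ : ∫ t in Set.Ioi β, w t = 0 :=
    setIntegral_eq_zero_of_forall_eq_zero fun t ht => hsupp t fun h => (h.2.trans ht).false
  set K' : Set ℝ := (K ∩ Set.Icc α β) ∪ {α, β} with hK'
  have hK'c : IsCompact K' :=
    (isCompact_Icc.inter_left hK).union (Set.Finite.isCompact (by simp))
  have hαK : α ∈ K' := Or.inr (by simp)
  have hβK : β ∈ K' := Or.inr (by simp)
  let Q : Set (ℝ × ℝ) := {p | p.1 ∈ K' ∧ p.2 ∈ K' ∧ p.1 < p.2 ∧ ∀ s ∈ Set.Ioo p.1 p.2, s ∉ K'}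
  have hQd : Q.PairwiseDisjoint fun p => Set.Ioo p.1 p.2 := by
    intro p hp q hq hpq
    refine Set.disjoint_left.2 fun s hs hs' => hpq ?_
    have e1 : p.1 = q.1 := by
      rcases lt_trichotomy p.1 q.1 with h | h | h
      · exact absurd hq.1 (hp.2.2.2 _ ⟨h, hs'.1.trans hs.2⟩)
      · exact h
      · exact absurd hp.1 (hq.2.2.2 _ ⟨h, hs.1.trans hs'.2⟩)
    have e2 : p.2 = q.2 := by
      rcases lt_trichotomy p.2 q.2 with h | h | h
      · exact absurd hp.2.1 (hq.2.2.2 _ ⟨hs'.1.trans hs.2, h⟩)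
      · exact h
      · exact absurd hq.2.1 (hp.2.2.2 _ ⟨hs.1.trans hs'.2, h⟩)
    exact Prod.ext e1 e2
  have hQc : Q.Countable := hQd.countable_of_isOpen (fun p _ => isOpen_Ioo)
    fun p hp => Set.nonempty_Ioo.2 hp.2.2.1
  have : Countable Q := hQc.to_subtype
  have hcover : ∀ s ∈ Set.Ioo α β, s ∉ K → ∃ p : Q, s ∈ Set.Ioo p.1.1 p.1.2 := by
    intro s hs hsK
    have hsK' : s ∉ K' := by
      rintro (h | h | h)
      · exact hsK h.1
      · exact hs.1.ne' h
      · exact hs.2.ne h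
    obtain ⟨x₁, hx₁, hx₁m⟩ := (hK'c.inter_right (isClosed_Iic (a := s))).exists_isGreatest
      ⟨α, hαK, hs.1.le⟩
    obtain ⟨x₂, hx₂, hx₂m⟩ := (hK'c.inter_right (isClosed_Ici (a := s))).exists_isLeast
      ⟨β, hβK, hs.2.le⟩
    have h1 : x₁ < s := lt_of_le_of_ne hx₁.2 fun h => hsK' (h ▸ hx₁.1)
    have h2 : s < x₂ := lt_of_le_of_ne hx₂.2 fun h => hsK' (h ▸ hx₂.1)
    refine ⟨⟨(x₁, x₂), hx₁.1, hx₂.1, h1.trans h2, fun t ht htK => ?_⟩, h1, h2⟩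
    rcases le_total t s with h | h
    · exact (hx₁m ⟨htK, h⟩).not_gt ht.1
    · exact (hx₂m ⟨htK, h⟩).not_gt ht.2
  have hQd' : Pairwise (Function.onFun Disjoint fun p : Q => Set.Ioo p.1.1 p.1.2) := by
    intro p q hpq
    exact hQd p.2 q.2 fun h => hpq (Subtype.ext h)
  have hgapK : ∀ p : Q, Disjoint (Set.Ioo p.1.1 p.1.2) K := by
    intro p
    have hpI : p.1.1 ∈ Set.Icc α β ∧ p.1.2 ∈ Set.Icc α β := by
      have : ∀ x ∈ K', x ∈ Set.Icc α β := by
        rintro x (h | h | h)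
        · exact h.2
        · rw [h]; exact ⟨le_rfl, hαβ.le⟩
        · rw [Set.mem_singleton_iff.1 h]; exact ⟨hαβ.le, le_rfl⟩
      exact ⟨this _ p.2.1, this _ p.2.2.1⟩
    exact Set.disjoint_left.2 fun s hs hsK => p.2.2.2.2 s hs
      (Or.inl ⟨hsK, hpI.1.1.trans hs.1.le, hs.2.le.trans hpI.2.2⟩)
  set q : Q → ℝ := fun p => ∫ s in Set.Ioo p.1.1 p.1.2, w s with hq
  have hq0 : ∀ p, 0 ≤ q p := fun p => setIntegral_nonneg measurableSet_Ioo fun t _ => h0 t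
  have hsumq : ∀ S : Finset Q, (∑ p ∈ S, q p) + ∫ s in K, w s ≤ 1 := by
    intro S
    rw [hq, ← integral_biUnion_finset S (fun _ _ => measurableSet_Ioo)
      (fun p _ p' _ h => hQd' h) (fun _ _ => hw.integrableOn), ← setIntegral_union _ hK.measurableSet
      hw.integrableOn hw.integrableOn, ← hw1]
    · exact setIntegral_le_integral hw (Filter.Eventually.of_forall h0)
    · simp only [Set.disjoint_iUnion_left]
      exact fun p _ => hgapK p
  have hgap : ∀ p : Q, l * ∫ s in A ∩ Set.Ioo p.1.1 p.1.2, w s ≤ -Real.log (1 - q p) := by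
    intro p
    have e : (∫ t in Set.Iic p.1.1, w t) + ∫ t in Set.Ioi p.1.2, w t = 1 - q p := by
      have e1 := intervalIntegral.integral_Iic_add_Ioi (b := p.1.1) (μ := volume) (f := w)
        hw.integrableOn hw.integrableOn
      have e2 : ∫ t in Set.Ioi p.1.1, w t = q p + ∫ t in Set.Ioi p.1.2, w t := by
        simp only [hq]
        rw [← integral_Ioc_eq_integral_Ioo, ← setIntegral_union _ measurableSet_Ioi
          hw.integrableOn hw.integrableOn, Set.Ioc_union_Ioi_eq_Ioi p.2.2.2.1.le]
        exact Set.disjoint_left.2 fun s hs hs' => (hs.2.trans_lt hs').false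
      rw [hw1] at e1
      linarith
    rw [← e]
    refine setIntegral_inter_Ioo_le_neg_log hwm hw h0 hlc hw1 hl p.2.2.2.1.le ?_ hA ?_ ?_
    · rw [e]
      have := hsumq {p}
      rw [Finset.sum_singleton] at this
      linarith
    · rcases p.2.1 with h | h | h
      · exact Or.inr (hK₁ _ h.1)
      · exact Or.inl (by rw [h, hzα])
      · refine absurd p.2.2.2.1 (not_lt.2 ?_)
        rw [Set.mem_singleton_iff.1 h]
        rcases p.2.2.1 with h | h | h
        · exact h.2.2
        · rw [h]; exact hαβ.le
        · exact (Set.mem_singleton_iff.1 h).le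
    · rcases p.2.2.1 with h | h | h
      · exact Or.inr (hK₂ _ h.1)
      · refine absurd p.2.2.2.1 (not_lt.2 ?_)
        rw [h]
        rcases p.2.1 with h | h | h
        · exact h.2.1
        · rw [h]
        · rw [Set.mem_singleton_iff.1 h]; exact hαβ.le
      · exact Or.inl (by rw [Set.mem_singleton_iff.1 h, hzβ])
  have hAeq : ∫ s in A, w s = ∫ s in ⋃ p : Q, A ∩ Set.Ioo p.1.1 p.1.2, w s := by
    have e1 : ∫ s in A, w s = ∫ s in A ∩ Set.Ioo α β, w s := by
      rw [← integral_indicator hA, ← integral_indicator (hA.inter measurableSet_Ioo)]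
      congr 1
      funext s
      by_cases hs : s ∈ A
      · by_cases hs' : s ∈ Set.Ioo α β
        · rw [Set.indicator_of_mem hs, Set.indicator_of_mem (Set.mem_inter hs hs')]
        · rw [Set.indicator_of_mem hs, Set.indicator_of_notMem fun h => hs' h.2, hsupp s hs']
      · rw [Set.indicator_of_notMem hs, Set.indicator_of_notMem fun h => hs h.1]
    rw [e1]
    refine le_antisymm (setIntegral_mono_set hw.integrableOn (Filter.Eventually.of_forall h0)
      (Filter.Eventually.of_forall fun s hs => ?_)) ?_
    · obtain ⟨p, hp⟩ := hcover s hs.2 (Set.disjoint_left.1 hAK hs.1)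
      exact Set.mem_iUnion.2 ⟨p, hs.1, hp⟩
    · rw [← e1]
      refine setIntegral_mono_set hw.integrableOn (Filter.Eventually.of_forall h0)
        (Filter.Eventually.of_forall fun s hs => ?_)
      obtain ⟨p, hp⟩ := Set.mem_iUnion.1 hs
      exact hp.1
  have hsum := hasSum_integral_iUnion (μ := volume) (f := w)
    (s := fun p : Q => A ∩ Set.Ioo p.1.1 p.1.2) (fun p => hA.inter measurableSet_Ioo)
    (fun p p' h => (hQd' h).mono Set.inter_subset_right Set.inter_subset_right) hw.integrableOn
  rw [hAeq]
  refine hasSum_le_of_sum_le (hsum.mul_left l) fun S => ?_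
  have hqlt : ∀ p, 0 < 1 - q p := fun p => by
    have := hsumq {p}
    rw [Finset.sum_singleton] at this
    linarith
  calc ∑ p ∈ S, l * ∫ s in A ∩ Set.Ioo p.1.1 p.1.2, w s
      ≤ ∑ p ∈ S, -Real.log (1 - q p) := Finset.sum_le_sum fun p _ => hgap p
    _ = -Real.log (∏ p ∈ S, (1 - q p)) := by
        rw [Finset.sum_neg_distrib, Real.log_prod fun p _ => (hqlt p).ne']
    _ ≤ -Real.log (∫ s in K, w s) := by
        refine neg_le_neg (Real.log_le_log hKpos ?_)
        have := one_sub_sum_le_prod_one_sub S q hq0 fun p _ => by linarith [hqlt p]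
        linarith [hsumq S]

section LogConcave

open scoped ENNReal Pointwise

lemma Real.volume_image_mul_add (a c : ℝ) (ha : 0 < a) (S : Set ℝ) :
    volume ((fun x => a * x + c) '' S) = ENNReal.ofReal a * volume S := by
  have : (fun x => a * x + c) '' S = c +ᵥ (a • S) := by
    rw [← Set.image_smul, ← Set.image_vadd, Set.image_image]
    simp [add_comm]
  rw [this, measure_vadd, Measure.addHaar_smul]
  simp [abs_of_pos ha]

lemma IsCompact.add_volume_le_of_add_mem {S T U : Set ℝ} {a b : ℝ} (ha : 0 < a) (hb : 0 < b)
    (hS : IsCompact S) (hT : IsCompact T) (hSn : S.Nonempty) (hTn : T.Nonempty)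
    (h : ∀ x ∈ S, ∀ y ∈ T, a * x + b * y ∈ U) :
    ENNReal.ofReal a * volume S + ENNReal.ofReal b * volume T ≤ volume U := by
  obtain ⟨x, hx, hxm⟩ := hS.exists_isGreatest hSn
  obtain ⟨y, hy, hym⟩ := hT.exists_isLeast hTn
  rw [← Real.volume_image_mul_add a (b * y) ha, ← Real.volume_image_mul_add b (a * x) hb,
    ← measure_union₀]
  · refine measure_mono (Set.union_subset ?_ ?_)
    · rintro _ ⟨s, hs, rfl⟩; exact h s hs y hy
    · rintro _ ⟨t, ht, rfl⟩; simpa only [add_comm] using h x hx t ht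
  · exact (hT.image (by fun_prop)).measurableSet.nullMeasurableSet
  · refine measure_mono_null (t := {a * x + b * y}) ?_ (measure_singleton _)
    rintro _ ⟨⟨s, hs, rfl⟩, ⟨t, ht, hst⟩⟩
    have h1 := mul_le_mul_of_nonneg_left (hxm hs) ha.le
    have h2 := mul_le_mul_of_nonneg_left (hym ht) hb.le
    simp only at hst ⊢
    rw [Set.mem_singleton_iff]
    linarith

lemma Real.volume_le_iSup_isCompact_nonempty {S : Set ℝ} (hS : MeasurableSet S) :
    volume S ≤ ⨆ K : {K : Set ℝ // K ⊆ S ∧ IsCompact K ∧ K.Nonempty}, volume K.1 := by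
  refine le_of_forall_lt fun r hr => ?_
  obtain ⟨K, hKS, hK, hrK⟩ := hS.exists_lt_isCompact hr
  refine lt_of_lt_of_le hrK (le_iSup (fun K : {K : Set ℝ // K ⊆ S ∧ IsCompact K ∧ K.Nonempty} =>
    volume K.1) ⟨K, hKS, hK, nonempty_of_measure_ne_zero (bot_le.trans_lt hrK).ne'⟩)

/-- The one-dimensional Brunn–Minkowski inequality. -/
lemma Real.add_volume_le_of_add_mem {S T U : Set ℝ} {a b : ℝ} (ha : 0 < a) (hb : 0 < b)
    (hS : MeasurableSet S) (hT : MeasurableSet T) (hSn : S.Nonempty) (hTn : T.Nonempty)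
    (h : ∀ x ∈ S, ∀ y ∈ T, a * x + b * y ∈ U) :
    ENNReal.ofReal a * volume S + ENNReal.ofReal b * volume T ≤ volume U := by
  obtain ⟨x, hx⟩ := hSn
  obtain ⟨y, hy⟩ := hTn
  have : Nonempty {K : Set ℝ // K ⊆ S ∧ IsCompact K ∧ K.Nonempty} :=
    ⟨⟨{x}, by simpa using hx, isCompact_singleton, by simp⟩⟩
  have : Nonempty {K : Set ℝ // K ⊆ T ∧ IsCompact K ∧ K.Nonempty} :=
    ⟨⟨{y}, by simpa using hy, isCompact_singleton, by simp⟩⟩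
  refine (add_le_add (mul_le_mul_right (Real.volume_le_iSup_isCompact_nonempty hS) _)
    (mul_le_mul_right (Real.volume_le_iSup_isCompact_nonempty hT) _)).trans ?_
  rw [ENNReal.mul_iSup, ENNReal.mul_iSup]
  refine ENNReal.iSup_add_iSup_le fun K L => ?_
  exact IsCompact.add_volume_le_of_add_mem ha hb K.2.2.1 L.2.2.1 K.2.2.2 L.2.2.2
    fun x hx y hy => h x (K.2.1 hx) y (L.2.1 hy)

lemma add_lintegral_le_of_sup_eq_one {f g h : ℝ → ℝ} {a b : ℝ} (ha : 0 < a) (hb : 0 < b)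
    (hf : Measurable f) (hg : Measurable g) (hh : Measurable h)
    (hf0 : ∀ x, 0 ≤ f x) (hg0 : ∀ x, 0 ≤ g x) (hh0 : ∀ x, 0 ≤ h x)
    (hf1 : ∀ x, f x ≤ 1) (hg1 : ∀ x, g x ≤ 1) (hfs : ∀ t < 1, ∃ x, t < f x)
    (hgs : ∀ t < 1, ∃ x, t < g x)
    (H : ∀ t x y, 0 < t → t < f x → t < g y → t < h (a * x + b * y)) :
    ENNReal.ofReal a * (∫⁻ x, ENNReal.ofReal (f x)) +
      ENNReal.ofReal b * (∫⁻ x, ENNReal.ofReal (g x)) ≤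
      ∫⁻ x, ENNReal.ofReal (h x) := by
  rw [lintegral_eq_lintegral_meas_lt _ (Filter.Eventually.of_forall hf0) hf.aemeasurable,
    lintegral_eq_lintegral_meas_lt _ (Filter.Eventually.of_forall hg0) hg.aemeasurable,
    lintegral_eq_lintegral_meas_lt _ (Filter.Eventually.of_forall hh0) hh.aemeasurable,
    ← lintegral_const_mul' _ _ ENNReal.ofReal_ne_top,
    ← lintegral_const_mul' _ _ ENNReal.ofReal_ne_top]
  have hanti : Antitone fun t => ENNReal.ofReal a * volume {x | t < f x} := fun s t hst =>
    mul_le_mul_right (measure_mono fun x hx => lt_of_le_of_lt hst hx) _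
  rw [← lintegral_add_left hanti.measurable]
  refine setLIntegral_mono' measurableSet_Ioi fun t ht => ?_
  rcases lt_or_ge t 1 with h1 | h1
  · exact Real.add_volume_le_of_add_mem ha hb (measurableSet_lt measurable_const hf)
      (measurableSet_lt measurable_const hg) (hfs t h1) (hgs t h1)
      fun x hx y hy => H t x y ht hx hy
  · have e1 : {x | t < f x} = ∅ := by
      ext x; simpa using (hf1 x).trans h1
    have e2 : {x | t < g x} = ∅ := by
      ext x; simpa using (hg1 x).trans h1
    simp [e1, e2]

lemma ENNReal.rpow_mul_rpow_le_add {x y : ℝ≥0∞} {a b : ℝ} (ha : 0 < a) (hb : 0 < b)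
    (hab : a + b = 1) : x ^ a * y ^ b ≤ ENNReal.ofReal a * x + ENNReal.ofReal b * y := by
  rcases eq_or_ne x ∞ with rfl | hx
  · rw [ENNReal.mul_top (by simpa using ha)]; simp
  rcases eq_or_ne y ∞ with rfl | hy
  · rw [ENNReal.mul_top (by simpa using hb)]; simp
  lift x to NNReal using hx
  lift y to NNReal using hy
  rw [← ENNReal.coe_rpow_of_nonneg _ ha.le, ← ENNReal.coe_rpow_of_nonneg _ hb.le,
    ENNReal.ofReal, ENNReal.ofReal]
  norm_cast
  have := NNReal.geom_mean_le_arith_mean2_weighted a.toNNReal b.toNNReal x y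
    (by rw [← Real.toNNReal_add ha.le hb.le, hab, Real.toNNReal_one])
  simpa [ha.le, hb.le] using this

lemma lintegral_rpow_mul_le_of_bounded {f g h : ℝ → ℝ≥0∞} {a b : ℝ} (ha : 0 < a) (hb : 0 < b)
    (hab : a + b = 1) (hf : Measurable f) (hg : Measurable g) (hh : Measurable h)
    {N : ℝ≥0∞} (hN : N ≠ ∞) (hfN : ∀ x, f x ≤ N) (hgN : ∀ x, g x ≤ N)
    (H : ∀ x y, f x ^ a * g y ^ b ≤ h (a * x + b * y)) :
    (∫⁻ x, f x) ^ a * (∫⁻ x, g x) ^ b ≤ ∫⁻ x, h x := by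
  set Fs := ⨆ x, f x with hFs
  set Gs := ⨆ x, g x with hGs
  have hFt : Fs ≠ ∞ := ne_top_of_le_ne_top hN (iSup_le hfN)
  have hGt : Gs ≠ ∞ := ne_top_of_le_ne_top hN (iSup_le hgN)
  rcases eq_or_ne Fs 0 with h0 | hF0
  · have : f = 0 := by simpa [hFs, funext_iff] using h0
    simp [this, ha]
  rcases eq_or_ne Gs 0 with h0 | hG0
  · have : g = 0 := by simpa [hGs, funext_iff] using h0
    simp [this, hb]
  set C := Fs ^ a * Gs ^ b with hC
  have hC0 : C ≠ 0 := mul_ne_zero (by simp [hF0, hFt, ENNReal.rpow_eq_zero_iff])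
    (by simp [hG0, hGt, ENNReal.rpow_eq_zero_iff])
  have hCt : C ≠ ∞ := ENNReal.mul_ne_top (ENNReal.rpow_ne_top_of_nonneg ha.le hFt)
    (ENNReal.rpow_ne_top_of_nonneg hb.le hGt)
  have hfd : ∀ x, f x / Fs ≤ 1 := fun x => ENNReal.div_le_of_le_mul (by
    rw [one_mul]; exact le_iSup f x)
  have hgd : ∀ x, g x / Gs ≤ 1 := fun x => ENNReal.div_le_of_le_mul (by
    rw [one_mul]; exact le_iSup g x)
  have hft : ∀ x, f x / Fs ≠ ∞ := fun x => ne_top_of_le_ne_top ENNReal.one_ne_top (hfd x)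
  have hgt : ∀ x, g x / Gs ≠ ∞ := fun x => ne_top_of_le_ne_top ENNReal.one_ne_top (hgd x)
  have hht : ∀ x, min (h x / C) 1 ≠ ∞ := fun x =>
    ne_top_of_le_ne_top ENNReal.one_ne_top (min_le_right _ _)
  have hsup : ∀ (u : ℝ → ℝ≥0∞), (⨆ x, u x) ≠ 0 → (⨆ x, u x) ≠ ∞ → (∀ x, u x / (⨆ x, u x) ≠ ∞) →
      ∀ t < 1, ∃ x, t < (u x / (⨆ x, u x)).toReal := by
    intro u hu0 hut hux t ht
    have : ENNReal.ofReal t * (⨆ x, u x) < ⨆ x, u x := by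
      conv_rhs => rw [← one_mul (⨆ x, u x)]
      exact (ENNReal.mul_lt_mul_iff_left hu0 hut).2 (by simpa using ht)
    obtain ⟨x, hx⟩ := lt_iSup_iff.1 this
    refine ⟨x, ?_⟩
    have : ENNReal.ofReal t < u x / (⨆ x, u x) := by
      rwa [ENNReal.lt_div_iff_mul_lt (Or.inl hu0) (Or.inl hut)]
    by_contra hcon
    rw [not_lt] at hcon
    rw [← ENNReal.ofReal_toReal (hux x)] at this
    exact absurd (ENNReal.ofReal_le_ofReal hcon) (not_le.2 this)
  have key := add_lintegral_le_of_sup_eq_one (f := fun x => (f x / Fs).toReal)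
    (g := fun x => (g x / Gs).toReal) (h := fun x => (min (h x / C) 1).toReal) ha hb
    (hf.div_const _).ennreal_toReal (hg.div_const _).ennreal_toReal
    ((hh.div_const _).min measurable_const).ennreal_toReal
    (fun _ => ENNReal.toReal_nonneg) (fun _ => ENNReal.toReal_nonneg)
    (fun _ => ENNReal.toReal_nonneg) (fun x => by simpa using ENNReal.toReal_mono (by simp) (hfd x))
    (fun x => by simpa using ENNReal.toReal_mono (by simp) (hgd x))
    (hsup f hF0 hFt hft) (hsup g hG0 hGt hgt) (by
      intro t x y ht hx hy
      have conv : ∀ {z : ℝ≥0∞}, z ≠ ∞ → (t < z.toReal ↔ ENNReal.ofReal t < z) := fun hz =>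
        (ENNReal.ofReal_lt_iff_lt_toReal ht.le hz).symm
      rw [conv (hft x)] at hx
      rw [conv (hgt y)] at hy
      rw [conv (hht _)]
      refine lt_min ?_ (hx.trans_le (hfd x))
      calc ENNReal.ofReal t = ENNReal.ofReal t ^ a * ENNReal.ofReal t ^ b := by
            rw [← ENNReal.rpow_add _ _ (by simpa using ht) ENNReal.ofReal_ne_top, hab,
              ENNReal.rpow_one]
        _ < (f x / Fs) ^ a * (g y / Gs) ^ b :=
            ENNReal.mul_lt_mul (ENNReal.rpow_lt_rpow hx ha) (ENNReal.rpow_lt_rpow hy hb)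
        _ = f x ^ a * g y ^ b / C := by
            rw [ENNReal.div_rpow_of_nonneg _ _ ha.le, ENNReal.div_rpow_of_nonneg _ _ hb.le, hC,
              ENNReal.mul_div_mul_comm]
            · left; simp [hF0, hFt, ENNReal.rpow_eq_zero_iff]
            · left; exact ENNReal.rpow_ne_top_of_nonneg ha.le hFt
        _ ≤ h (a * x + b * y) / C := ENNReal.div_le_div_right (H x y) C)
  simp only [ENNReal.ofReal_toReal (hft _), ENNReal.ofReal_toReal (hgt _),
    ENNReal.ofReal_toReal (hht _)] at key
  have e1 : ∫⁻ x, f x = Fs * ∫⁻ x, f x / Fs := by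
    rw [← lintegral_const_mul' _ _ hFt]
    exact lintegral_congr fun x => (ENNReal.mul_div_cancel hF0 hFt).symm
  have e2 : ∫⁻ x, g x = Gs * ∫⁻ x, g x / Gs := by
    rw [← lintegral_const_mul' _ _ hGt]
    exact lintegral_congr fun x => (ENNReal.mul_div_cancel hG0 hGt).symm
  calc (∫⁻ x, f x) ^ a * (∫⁻ x, g x) ^ b
      = C * ((∫⁻ x, f x / Fs) ^ a * (∫⁻ x, g x / Gs) ^ b) := by
        rw [e1, e2, ENNReal.mul_rpow_of_nonneg _ _ ha.le, ENNReal.mul_rpow_of_nonneg _ _ hb.le, hC]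
        ring
    _ ≤ C * ∫⁻ x, min (h x / C) 1 :=
        mul_le_mul_right ((ENNReal.rpow_mul_rpow_le_add ha hb hab).trans key) _
    _ ≤ C * ∫⁻ x, h x / C := mul_le_mul_right (lintegral_mono fun x => min_le_left _ _) _
    _ = ∫⁻ x, h x := by
        rw [← lintegral_const_mul' _ _ hCt]
        exact lintegral_congr fun x => ENNReal.mul_div_cancel hC0 hCt

/-- The one-dimensional Prékopa–Leindler inequality. -/
theorem lintegral_rpow_mul_lintegral_rpow_le {f g h : ℝ → ℝ≥0∞} {a b : ℝ} (ha : 0 < a) (hb : 0 < b)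
    (hab : a + b = 1) (hf : Measurable f) (hg : Measurable g) (hh : Measurable h)
    (H : ∀ x y, f x ^ a * g y ^ b ≤ h (a * x + b * y)) :
    (∫⁻ x, f x) ^ a * (∫⁻ x, g x) ^ b ≤ ∫⁻ x, h x := by
  have trunc : ∀ u : ℝ → ℝ≥0∞, Measurable u →
      ∫⁻ x, u x = ⨆ n : ℕ, ∫⁻ x, min (u x) n := by
    intro u hu
    rw [← lintegral_iSup (fun n => hu.min measurable_const)]
    · refine lintegral_congr fun x => ?_
      rw [← inf_iSup_eq, ENNReal.iSup_natCast]
      simp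
    · exact fun n m hnm x => min_le_min_left _ (by exact_mod_cast hnm)
  have hiso : ∀ {c : ℝ} (hc : 0 < c) (u : ℕ → ℝ≥0∞), (⨆ n, u n) ^ c = ⨆ n, u n ^ c :=
    fun hc u => (ENNReal.orderIsoRpow _ hc).map_iSup u
  rw [trunc f hf, trunc g hg, hiso ha, hiso hb, ENNReal.iSup_mul]
  refine iSup_le fun n => ?_
  rw [ENNReal.mul_iSup]
  refine iSup_le fun m => ?_
  refine lintegral_rpow_mul_le_of_bounded (N := max n m) ha hb hab (hf.min measurable_const)
    (hg.min measurable_const) hh (by simp) (fun x => (min_le_right _ _).trans (le_max_left _ _))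
    (fun x => (min_le_right _ _).trans (le_max_right _ _)) fun x y => le_trans ?_ (H x y)
  gcongr
  · exact min_le_left _ _
  · exact min_le_left _ _

/-- Log-concavity for functions with values in `ℝ≥0∞`. -/
def IsLogConcave {E : Type*} [AddCommGroup E] [Module ℝ E] (f : E → ℝ≥0∞) : Prop :=
  ∀ (x y : E) (a b : ℝ), 0 < a → 0 < b → a + b = 1 → f x ^ a * f y ^ b ≤ f (a • x + b • y)

lemma Convex.isLogConcave_indicator {E : Type*} [AddCommGroup E] [Module ℝ E] {F : Set E}
    (hF : Convex ℝ F) : IsLogConcave (F.indicator (1 : E → ℝ≥0∞)) := by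
  intro x y a b ha hb hab
  by_cases hx : x ∈ F
  · by_cases hy : y ∈ F
    · simp [hx, hy, hF hx hy ha.le hb.le hab]
    · simp [hy, hb]
  · simp [hx, ha]

/-- Marginals of log-concave functions are log-concave. -/
lemma IsLogConcave.lmarginal {ι : Type*} [DecidableEq ι] {f : (ι → ℝ) → ℝ≥0∞}
    (hf : IsLogConcave f) (hfm : Measurable f) (s : Finset ι) :
    IsLogConcave (lmarginal (fun _ => (volume : Measure ℝ)) s f) := by
  induction s using Finset.induction_on with
  | empty => simpa using hf
  | insert i s hi ih =>
    intro x y a b ha hb hab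
    have hm : Measurable (MeasureTheory.lmarginal (fun _ => (volume : Measure ℝ)) s f) :=
      hfm.lmarginal _
    simp only [lmarginal_insert f hfm hi]
    refine lintegral_rpow_mul_lintegral_rpow_le ha hb hab
      (hm.comp (measurable_update x)) (hm.comp (measurable_update y))
      (hm.comp (measurable_update _)) fun u v => ?_
    have e : Function.update (a • x + b • y) i (a * u + b * v) =
        a • Function.update x i u + b • Function.update y i v := by
      ext j
      by_cases h : j = i
      · subst h; simp
      · simp [h]
    rw [e]
    exact ih _ _ a b ha hb hab

lemma IsLogConcave.mul_le_mul {w : ℝ → ℝ≥0∞} (hw : IsLogConcave w) {s s' τ : ℝ} (hs : s ≤ s')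
    (hτ : 0 ≤ τ) : w s * w (s' + τ) ≤ w s' * w (s + τ) := by
  rcases hs.eq_or_lt with rfl | hs
  · exact le_rfl
  rcases hτ.eq_or_lt with rfl | hτ
  · simp [mul_comm]
  have hD : 0 < s' + τ - s := by linarith
  set t := (s' - s) / (s' + τ - s) with ht
  have ht0 : 0 < t := div_pos (by linarith) hD
  have ht1 : 0 < 1 - t := by
    rw [ht, sub_pos, div_lt_one hD]; linarith
  have htD : t * (s' + τ - s) = s' - s := div_mul_cancel₀ _ hD.ne'
  have h1 := hw s (s' + τ) (1 - t) t ht1 ht0 (by ring)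
  have h2 := hw s (s' + τ) t (1 - t) ht0 ht1 (by ring)
  have e1 : (1 - t) • s + t • (s' + τ) = s' := by
    simp only [smul_eq_mul]; linarith
  have e2 : t • s + (1 - t) • (s' + τ) = s + τ := by
    simp only [smul_eq_mul]; linarith
  rw [e1] at h1
  rw [e2] at h2
  have hp : ∀ z : ℝ≥0∞, z ^ (1 - t) * z ^ t = z := fun z => by
    rw [← ENNReal.rpow_add_of_nonneg _ _ ht1.le ht0.le, sub_add_cancel, ENNReal.rpow_one]
  calc w s * w (s' + τ)
      = (w s ^ (1 - t) * w s ^ t) * (w (s' + τ) ^ (1 - t) * w (s' + τ) ^ t) := by rw [hp, hp]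
    _ = (w s ^ (1 - t) * w (s' + τ) ^ t) * (w s ^ t * w (s' + τ) ^ (1 - t)) := by ring
    _ ≤ _ := mul_le_mul' h1 h2

/-- The distribution of a coordinate on a convex body has a log-concave density. -/
lemma exists_density_of_convex {ι : Type*} [Fintype ι] [DecidableEq ι] (i : ι) {F : Set (ι → ℝ)}
    (hFc : IsCompact F) (hFconv : Convex ℝ F) (hF0 : volume F ≠ 0) :
    ∃ w : ℝ → ℝ, Measurable w ∧ Integrable w ∧ (∀ s, 0 ≤ w s) ∧
      (∀ s s' τ, s ≤ s' → 0 ≤ τ → w s * w (s' + τ) ≤ w s' * w (s + τ)) ∧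
      (∃ α β, ∀ s, s ∉ Set.Ioo α β → w s = 0) ∧
      (∀ B : Set ℝ, MeasurableSet B →
        ∫ s in B, w s = (volume (F ∩ {z | z i ∈ B})).toReal / (volume F).toReal) := by
  have hFm : MeasurableSet F := hFc.measurableSet
  have hFt : volume F ≠ ∞ := hFc.measure_lt_top.ne
  set f : (ι → ℝ) → ℝ≥0∞ := F.indicator 1 with hf
  have hfm : Measurable f := measurable_one.indicator hFm
  set W : ℝ → ℝ≥0∞ := fun s =>
    MeasureTheory.lmarginal (fun _ => (volume : Measure ℝ)) (Finset.univ.erase i) f (fun _ => s)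
    with hW
  have hWm : Measurable W := (hfm.lmarginal _).comp (measurable_pi_lambda _ fun _ => measurable_id)
  have hWlc : IsLogConcave W := fun s s' a b ha hb hab =>
    (hFconv.isLogConcave_indicator.lmarginal hfm (Finset.univ.erase i)) (fun _ => s) (fun _ => s')
      a b ha hb hab
  obtain ⟨R, hR⟩ := hFc.isBounded.subset_closedBall (0 : ι → ℝ)
  have hR' : ∀ z ∈ F, ∀ j, |z j| ≤ R := fun z hz j => by
    have := hR hz
    rw [mem_closedBall_zero_iff] at this
    exact (norm_le_pi_norm z j).trans this
  have hWt : ∀ s, W s ≠ ∞ := by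
    intro s
    refine ne_top_of_le_ne_top (b := volume (Metric.closedBall
      (0 : ↥(Finset.univ.erase i) → ℝ) |R|)) measure_closedBall_lt_top.ne ?_
    rw [← lintegral_indicator_one measurableSet_closedBall]
    refine lintegral_mono fun y => ?_
    by_cases hy : Function.updateFinset (fun _ => s) (Finset.univ.erase i) y ∈ F
    · have : y ∈ Metric.closedBall (0 : ↥(Finset.univ.erase i) → ℝ) |R| := by
        rw [mem_closedBall_zero_iff, pi_norm_le_iff_of_nonneg (abs_nonneg _)]
        intro j
        have := hR' _ hy j
        rw [Function.updateFinset, dif_pos j.2] at this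
        exact this.trans (le_abs_self R)
      rw [Set.indicator_of_mem this, hf, Set.indicator_of_mem hy]; rfl
    · rw [hf, Set.indicator_of_notMem hy]; exact zero_le
  have hui : ∀ (s : ℝ) (y : ↥(Finset.univ.erase i) → ℝ),
      Function.updateFinset (fun _ => s) (Finset.univ.erase i) y i = s := fun s y => by
    simp [Function.updateFinset]
  have hmass : ∀ B : Set ℝ, MeasurableSet B →
      ∫⁻ s in B, W s = volume (F ∩ {z | z i ∈ B}) := by
    intro B hB
    have hBm : MeasurableSet {z : ι → ℝ | z i ∈ B} := measurable_pi_apply i hB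
    have hgm : Measurable ((F ∩ {z | z i ∈ B}).indicator (1 : (ι → ℝ) → ℝ≥0∞)) :=
      measurable_one.indicator (hFm.inter hBm)
    rw [← lintegral_indicator_one (hFm.inter hBm), volume_pi, lintegral_eq_lmarginal_univ 0,
      lmarginal_erase _ hgm (Finset.mem_univ i), ← lintegral_indicator hB]
    refine lintegral_congr fun s => ?_
    have hc := lmarginal_congr (s := Finset.univ.erase i) (fun _ => (volume : Measure ℝ))
      (x := Function.update (0 : ι → ℝ) i s) (y := fun _ => s)
      ((F ∩ {z | z i ∈ B}).indicator (1 : (ι → ℝ) → ℝ≥0∞)) (fun j hj => by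
        have : j = i := by simpa using hj
        subst this; simp)
    rw [hc]
    by_cases hs : s ∈ B
    · rw [Set.indicator_of_mem hs]
      refine lintegral_congr fun y => ?_
      have : Function.updateFinset (fun _ => s) (Finset.univ.erase i) y ∈ {z : ι → ℝ | z i ∈ B} := by
        change _ ∈ B
        rwa [hui]
      by_cases hF : Function.updateFinset (fun _ => s) (Finset.univ.erase i) y ∈ F
      · rw [Set.indicator_of_mem (Set.mem_inter hF this), hf, Set.indicator_of_mem hF]
      · rw [Set.indicator_of_notMem fun h => hF h.1, hf, Set.indicator_of_notMem hF]
    · rw [Set.indicator_of_notMem hs, MeasureTheory.lmarginal]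
      refine (lintegral_eq_zero_of_ae_eq_zero (Filter.Eventually.of_forall fun y => ?_)).symm
      refine Set.indicator_of_notMem (fun h => hs ?_) _
      have := h.2
      change _ ∈ B at this
      rwa [hui] at this
  have hWint : ∫⁻ s, W s = volume F := by
    have := hmass Set.univ MeasurableSet.univ
    simpa using this
  have hV : 0 < (volume F).toReal := ENNReal.toReal_pos hF0 hFt
  have hWi : Integrable fun s => (W s).toReal :=
    integrable_toReal_of_lintegral_ne_top hWm.aemeasurable (by rwa [hWint])
  refine ⟨fun s => (W s).toReal / (volume F).toReal, hWm.ennreal_toReal.div_const _,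
    hWi.div_const _, fun s => div_nonneg ENNReal.toReal_nonneg hV.le, fun s s' τ hs hτ => ?_,
    ⟨-R - 1, R + 1, fun s hs => ?_⟩, fun B hB => ?_⟩
  · have h := ENNReal.toReal_mono (ENNReal.mul_ne_top (hWt _) (hWt _)) (hWlc.mul_le_mul hs hτ)
    rw [ENNReal.toReal_mul, ENNReal.toReal_mul] at h
    rw [div_mul_div_comm, div_mul_div_comm]
    gcongr
  · have : W s = 0 := by
      refine lintegral_eq_zero_of_ae_eq_zero (Filter.Eventually.of_forall fun y => ?_)
      refine Set.indicator_of_notMem (fun h => hs ?_) _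
      have := hR' _ h i
      rw [hui, abs_le] at this
      exact ⟨by linarith, by linarith⟩
    simp [this]
  · rw [integral_div, integral_toReal hWm.aemeasurable
      (Filter.Eventually.of_forall fun s => (hWt s).lt_top), hmass B hB]

end LogConcave

/-- The distribution inequality for a polynomial in one coordinate of a convex body. -/
lemma mul_volume_sublevel_coord_le {ι : Type*} [Fintype ι] (i : ι) {F : Set (ι → ℝ)}
    (hFc : IsCompact F) (hFconv : Convex ℝ F) (hF0 : volume F ≠ 0) {d : ℕ} {p : Polynomial ℝ}
    (hp : p.natDegree ≤ d) {l m : ℝ} (hl : 1 ≤ l) (hm : 0 < m)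
    (hK : volume {z ∈ F | (4 * l) ^ d * m ≤ |p.eval (z i)|} ≠ 0) :
    l * ((volume {z ∈ F | |p.eval (z i)| < m}).toReal / (volume F).toReal) ≤
      -Real.log ((volume {z ∈ F | (4 * l) ^ d * m ≤ |p.eval (z i)|}).toReal /
        (volume F).toReal) := by
  classical
  obtain ⟨w, hwm, hw, h0, hlc, ⟨α, β, hsupp⟩, hB⟩ := exists_density_of_convex i hFc hFconv hF0
  have hFt : volume F ≠ ⊤ := hFc.measure_lt_top.ne
  have hV : 0 < (volume F).toReal := ENNReal.toReal_pos hF0 hFt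
  set A : Set ℝ := {t | |p.eval t| < m} with hA
  set K : Set ℝ := {t | (4 * l) ^ d * m ≤ |p.eval t|} with hKd
  have hpc : Continuous fun t => |p.eval t| := p.continuous.abs
  have hAm : MeasurableSet A := (isOpen_lt hpc continuous_const).measurableSet
  have hKc : IsClosed K := isClosed_le continuous_const hpc
  have eA : {z ∈ F | |p.eval (z i)| < m} = F ∩ {z | z i ∈ A} := rfl
  have eK : {z ∈ F | (4 * l) ^ d * m ≤ |p.eval (z i)|} = F ∩ {z | z i ∈ K} := rfl
  rw [eK] at hK
  rw [eA, eK, ← hB A hAm, ← hB K hKc.measurableSet]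
  have hl0 : 0 < l := by linarith
  refine mul_setIntegral_le_neg_log hwm hw h0 hlc ?_ hsupp hl0 hAm hKc ?_ ?_
    (fun x hx y hxy => volume_sublevel_Icc_right_le p hp hl0 hx hxy)
    (fun x hx y hyx => volume_sublevel_Icc_left_le p hp hl0 hx hyx)
  · have := hB Set.univ MeasurableSet.univ
    simpa [hV.ne'] using this
  · refine Set.disjoint_left.2 fun t ht ht' => ?_
    have h1 : |p.eval t| < m := ht
    have h2 : (4 * l) ^ d * m ≤ |p.eval t| := ht'
    have h3 : 1 ≤ (4 * l) ^ d := one_le_pow₀ (by linarith)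
    nlinarith
  · rw [hB K hKc.measurableSet]
    exact div_pos (ENNReal.toReal_pos hK
      (measure_ne_top_of_subset Set.inter_subset_left hFt)) hV

lemma volume_setOf_linear_eq_zero {ι : Type*} [Fintype ι] (L : (ι → ℝ) →ₗ[ℝ] ℝ) (hL : L ≠ 0)
    (c : ℝ) : volume {z | L z = c} = 0 := by
  rcases Set.eq_empty_or_nonempty {z | L z = c} with h | ⟨z₀, hz₀⟩
  · rw [h, measure_empty]
  · have e : {z | L z = c} = (fun z => z + -z₀) ⁻¹' (LinearMap.ker L : Set (ι → ℝ)) := by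
      ext z
      have : L z₀ = c := hz₀
      simp only [Set.mem_ofPred_eq, Set.mem_preimage, SetLike.mem_coe, LinearMap.mem_ker, map_add,
        map_neg, this]
      constructor <;> intro h <;> linarith
    rw [e, measure_preimage_add_right]
    exact Measure.addHaar_submodule _ _ fun h => hL (LinearMap.ker_eq_top.1 h)

/-- A closed half-space whose boundary passes through a given codimension two coordinate flat. -/
def coordHalfSpace {ι : Type*} (i j : ι) (q₁ q₂ θ : ℝ) : Set (ι → ℝ) :=
  {z | 0 ≤ Real.cos θ * (z i - q₁) + Real.sin θ * (z j - q₂)}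

lemma isClosed_coordHalfSpace {ι : Type*} (i j : ι) (q₁ q₂ θ : ℝ) :
    IsClosed (coordHalfSpace i j q₁ q₂ θ) :=
  isClosed_le continuous_const (by fun_prop)

lemma convex_coordHalfSpace {ι : Type*} (i j : ι) (q₁ q₂ θ : ℝ) :
    Convex ℝ (coordHalfSpace i j q₁ q₂ θ) := by
  intro x hx y hy a b ha hb hab
  have hx' : 0 ≤ Real.cos θ * (x i - q₁) + Real.sin θ * (x j - q₂) := hx
  have hy' : 0 ≤ Real.cos θ * (y i - q₁) + Real.sin θ * (y j - q₂) := hy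
  change 0 ≤ Real.cos θ * (a * x i + b * y i - q₁) + Real.sin θ * (a * x j + b * y j - q₂)
  have e : Real.cos θ * (a * x i + b * y i - q₁) + Real.sin θ * (a * x j + b * y j - q₂) =
      a * (Real.cos θ * (x i - q₁) + Real.sin θ * (x j - q₂)) +
      b * (Real.cos θ * (y i - q₁) + Real.sin θ * (y j - q₂)) := by
    obtain rfl : b = 1 - a := by linarith
    ring
  rw [e]; positivity

lemma volume_coordHalfSpace_boundary {ι : Type*} [Fintype ι] {i j : ι} (hij : i ≠ j)
    (q₁ q₂ θ : ℝ) :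
    volume {z : ι → ℝ | Real.cos θ * (z i - q₁) + Real.sin θ * (z j - q₂) = 0} = 0 := by
  classical
  let L : (ι → ℝ) →ₗ[ℝ] ℝ := Real.cos θ • LinearMap.proj i + Real.sin θ • LinearMap.proj j
  have hL : L ≠ 0 := by
    intro h
    have h1 := LinearMap.congr_fun h (Pi.single i 1)
    have h2 := LinearMap.congr_fun h (Pi.single j 1)
    simp [L, hij, hij.symm] at h1 h2
    have := Real.sin_sq_add_cos_sq θ
    rw [h1, h2] at this
    norm_num at this
  convert volume_setOf_linear_eq_zero L hL (Real.cos θ * q₁ + Real.sin θ * q₂) using 2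
  ext z
  simp only [Set.mem_ofPred_eq, L, LinearMap.add_apply, LinearMap.smul_apply, LinearMap.proj_apply,
    smul_eq_mul]
  constructor <;> intro h <;> linarith

lemma setIntegral_coordHalfSpace_add {ι : Type*} [Fintype ι] {i j : ι} (hij : i ≠ j)
    (q₁ q₂ θ : ℝ) {F : Set (ι → ℝ)} (hF : MeasurableSet F) {φ : (ι → ℝ) → ℝ}
    (hφ : IntegrableOn φ F) :
    (∫ z in F ∩ coordHalfSpace i j q₁ q₂ θ, φ z) +
      ∫ z in F ∩ coordHalfSpace i j q₁ q₂ (θ + Real.pi), φ z = ∫ z in F, φ z := by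
  have hm := fun θ => hF.inter (isClosed_coordHalfSpace i j q₁ q₂ θ).measurableSet
  have e : ∫ z in F ∩ coordHalfSpace i j q₁ q₂ (θ + Real.pi), φ z =
      ∫ z in F \ coordHalfSpace i j q₁ q₂ θ, φ z := by
    refine setIntegral_congr_set ?_
    have hne : ∀ᵐ z : ι → ℝ, Real.cos θ * (z i - q₁) + Real.sin θ * (z j - q₂) ≠ 0 := by
      rw [ae_iff]; simpa using volume_coordHalfSpace_boundary hij q₁ q₂ θ
    filter_upwards [hne] with z hz
    refine propext (and_congr_right fun _ => ?_)
    change 0 ≤ Real.cos (θ + Real.pi) * (z i - q₁) + Real.sin (θ + Real.pi) * (z j - q₂) ↔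
      ¬ (0 ≤ Real.cos θ * (z i - q₁) + Real.sin θ * (z j - q₂))
    rw [Real.cos_add_pi, Real.sin_add_pi, not_le]
    constructor
    · intro h; exact lt_of_le_of_ne (by linarith) hz
    · intro h; linarith
  rw [e]
  exact integral_inter_add_sdiff (isClosed_coordHalfSpace i j q₁ q₂ θ).measurableSet hφ

lemma continuous_setIntegral_coordHalfSpace {ι : Type*} [Fintype ι] {i j : ι} (hij : i ≠ j)
    (q₁ q₂ : ℝ) {F : Set (ι → ℝ)} {φ : (ι → ℝ) → ℝ} (hφ : IntegrableOn φ F) :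
    Continuous fun θ => ∫ z in F ∩ coordHalfSpace i j q₁ q₂ θ, φ z := by
  have hm := fun θ => (isClosed_coordHalfSpace i j q₁ q₂ θ).measurableSet
  have e : (fun θ => ∫ z in F ∩ coordHalfSpace i j q₁ q₂ θ, φ z) =
      fun θ => ∫ z in F, (coordHalfSpace i j q₁ q₂ θ).indicator φ z :=
    funext fun θ => (setIntegral_indicator (hm θ)).symm
  rw [e, continuous_iff_continuousAt]
  intro θ₀
  refine continuousAt_of_dominated (bound := fun z => ‖φ z‖)
    (Filter.Eventually.of_forall fun θ => hφ.aestronglyMeasurable.indicator (hm θ))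
    (Filter.Eventually.of_forall fun θ => Filter.Eventually.of_forall fun z =>
      norm_indicator_le_norm_self _ _) hφ.norm ?_
  have hne : ∀ᵐ z : ι → ℝ, Real.cos θ₀ * (z i - q₁) + Real.sin θ₀ * (z j - q₂) ≠ 0 := by
    rw [ae_iff]; simpa using volume_coordHalfSpace_boundary hij q₁ q₂ θ₀
  filter_upwards [ae_restrict_of_ae hne] with z hz
  have hc : Continuous fun θ => Real.cos θ * (z i - q₁) + Real.sin θ * (z j - q₂) := by fun_prop
  rcases lt_or_gt_of_ne hz with h | h
  · refine (continuousAt_const (y := (0 : ℝ))).congr (f := fun _ => (0 : ℝ)) ?_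
    filter_upwards [hc.continuousAt.eventually_lt_const h] with θ hθ
    exact (Set.indicator_of_notMem (fun h' : z ∈ coordHalfSpace i j q₁ q₂ θ =>
      not_le.2 hθ h') φ).symm
  · refine (continuousAt_const (y := φ z)).congr ?_
    filter_upwards [hc.continuousAt.eventually_const_lt h] with θ hθ
    exact (Set.indicator_of_mem (show z ∈ coordHalfSpace i j q₁ q₂ θ from hθ.le) _).symm

/-- One step of the localization procedure: a convex body is cut by a half-space through a given
codimension two coordinate flat, preserving the sign of two integrals. -/
lemma exists_bisection {ι : Type*} [Fintype ι] {i j : ι} (hij : i ≠ j) (q₁ q₂ : ℝ)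
    {F : Set (ι → ℝ)} (hFc : IsCompact F) (hFconv : Convex ℝ F) {φ ψ : (ι → ℝ) → ℝ}
    (hφ : IntegrableOn φ F) (hψ : IntegrableOn ψ F) (hφ0 : 0 < ∫ z in F, φ z)
    (hψ0 : 0 ≤ ∫ z in F, ψ z) :
    ∃ G ⊆ F, IsCompact G ∧ Convex ℝ G ∧ 0 < (∫ z in G, φ z) ∧ 0 ≤ (∫ z in G, ψ z) ∧
      ∃ θ : ℝ, G ⊆ coordHalfSpace i j q₁ q₂ θ := by
  set h : ℝ → ℝ := fun θ => ∫ z in F ∩ coordHalfSpace i j q₁ q₂ θ, φ z with hh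
  have hc : Continuous h := continuous_setIntegral_coordHalfSpace hij q₁ q₂ hφ
  have hsum : ∀ θ, h θ + h (θ + Real.pi) = ∫ z in F, φ z := fun θ =>
    setIntegral_coordHalfSpace_add hij q₁ q₂ θ hFc.measurableSet hφ
  obtain ⟨θ, -, hθ⟩ : ∃ θ ∈ Set.uIcc 0 (0 + Real.pi), h θ = (∫ z in F, φ z) / 2 := by
    refine intermediate_value_uIcc hc.continuousOn ?_
    have := hsum 0
    rw [Set.mem_uIcc]
    rcases le_total (h 0) ((∫ z in F, φ z) / 2) with h' | h'
    · left; constructor <;> linarith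
    · right; constructor <;> linarith
  have hfin : ∀ θ, 0 < h θ → 0 ≤ (∫ z in F ∩ coordHalfSpace i j q₁ q₂ θ, ψ z) →
      ∃ G ⊆ F, IsCompact G ∧ Convex ℝ G ∧ 0 < (∫ z in G, φ z) ∧ 0 ≤ (∫ z in G, ψ z) ∧
      ∃ θ : ℝ, G ⊆ coordHalfSpace i j q₁ q₂ θ := fun θ h1 h2 =>
    ⟨_, Set.inter_subset_left, hFc.inter_right (isClosed_coordHalfSpace i j q₁ q₂ θ),
      hFconv.inter (convex_coordHalfSpace i j q₁ q₂ θ), h1, h2, θ, Set.inter_subset_right⟩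
  have hψs := setIntegral_coordHalfSpace_add hij q₁ q₂ θ hFc.measurableSet hψ
  have hs := hsum θ
  rcases le_or_gt 0 (∫ z in F ∩ coordHalfSpace i j q₁ q₂ θ, ψ z) with h' | h'
  · exact hfin θ (by linarith) h'
  · exact hfin (θ + Real.pi) (by linarith) (by linarith)

lemma exists_rat_interior_triangle (x₁ x₂ y₁ y₂ z₁ z₂ : ℝ)
    (hD : (y₁ - x₁) * (z₂ - x₂) - (y₂ - x₂) * (z₁ - x₁) ≠ 0) :
    ∃ q : ℚ × ℚ, ∀ u v : ℝ, 0 ≤ u * (x₁ - q.1) + v * (x₂ - q.2) →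
      0 ≤ u * (y₁ - q.1) + v * (y₂ - q.2) → 0 ≤ u * (z₁ - q.1) + v * (z₂ - q.2) →
      u = 0 ∧ v = 0 := by
  set D := (y₁ - x₁) * (z₂ - x₂) - (y₂ - x₂) * (z₁ - x₁) with hDd
  let s : ℝ × ℝ → ℝ := fun q => ((q.1 - x₁) * (z₂ - x₂) - (q.2 - x₂) * (z₁ - x₁)) / D
  let t : ℝ × ℝ → ℝ := fun q => ((y₁ - x₁) * (q.2 - x₂) - (y₂ - x₂) * (q.1 - x₁)) / D
  have hs : Continuous s := by fun_prop
  have ht : Continuous t := by fun_prop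
  have hopen : IsOpen {q : ℝ × ℝ | 0 < s q ∧ 0 < t q ∧ s q + t q < 1} :=
    (isOpen_lt continuous_const hs).inter
      ((isOpen_lt continuous_const ht).inter (isOpen_lt (hs.add ht) continuous_const))
  have hne : {q : ℝ × ℝ | 0 < s q ∧ 0 < t q ∧ s q + t q < 1}.Nonempty := by
    refine ⟨((x₁ + y₁ + z₁) / 3, (x₂ + y₂ + z₂) / 3), ?_⟩
    have h1 : s ((x₁ + y₁ + z₁) / 3, (x₂ + y₂ + z₂) / 3) = 1 / 3 := by
      simp only [s]; rw [div_eq_iff hD, hDd]; ring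
    have h2 : t ((x₁ + y₁ + z₁) / 3, (x₂ + y₂ + z₂) / 3) = 1 / 3 := by
      simp only [t]; rw [div_eq_iff hD, hDd]; ring
    simp only [Set.mem_ofPred_eq, h1, h2]
    norm_num
  have hdense : DenseRange (Prod.map ((↑) : ℚ → ℝ) ((↑) : ℚ → ℝ)) :=
    Rat.denseRange_cast.prodMap Rat.denseRange_cast
  obtain ⟨q, hq1, hq2, hq3⟩ := hdense.exists_mem_open hopen hne
  refine ⟨q, fun u v hx hy hz => ?_⟩
  simp only [Prod.map] at hq1 hq2 hq3
  set S := s ((q.1 : ℝ), (q.2 : ℝ)) with hS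
  set T := t ((q.1 : ℝ), (q.2 : ℝ)) with hT
  have e1 : (q.1 : ℝ) - x₁ = S * (y₁ - x₁) + T * (z₁ - x₁) := by
    simp only [hS, hT, s, t]; field_simp; rw [hDd]; ring
  have e2 : (q.2 : ℝ) - x₂ = S * (y₂ - x₂) + T * (z₂ - x₂) := by
    simp only [hS, hT, s, t]; field_simp; rw [hDd]; ring
  have key : (1 - S - T) * (u * (x₁ - q.1) + v * (x₂ - q.2)) +
      S * (u * (y₁ - q.1) + v * (y₂ - q.2)) + T * (u * (z₁ - q.1) + v * (z₂ - q.2)) = 0 := by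
    linear_combination (-u) * e1 - v * e2
  have a1 : 0 < 1 - S - T := by linarith
  have p1 := mul_nonneg a1.le hx
  have p2 := mul_nonneg hq1.le hy
  have p3 := mul_nonneg hq2.le hz
  have b1 : u * (x₁ - q.1) + v * (x₂ - q.2) = 0 :=
    (mul_eq_zero.1 (by linarith : (1 - S - T) * (u * (x₁ - q.1) + v * (x₂ - q.2)) = 0)).resolve_left
      a1.ne'
  have b2 : u * (y₁ - q.1) + v * (y₂ - q.2) = 0 :=
    (mul_eq_zero.1 (by linarith : S * (u * (y₁ - q.1) + v * (y₂ - q.2)) = 0)).resolve_left hq1.ne'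
  have b3 : u * (z₁ - q.1) + v * (z₂ - q.2) = 0 :=
    (mul_eq_zero.1 (by linarith : T * (u * (z₁ - q.1) + v * (z₂ - q.2)) = 0)).resolve_left hq2.ne'
  have c1 : u * (y₁ - x₁) + v * (y₂ - x₂) = 0 := by linarith
  have c2 : u * (z₁ - x₁) + v * (z₂ - x₂) = 0 := by linarith
  constructor
  · refine (mul_eq_zero.1 (?_ : u * D = 0)).resolve_right hD
    rw [hDd]; linear_combination (z₂ - x₂) * c1 - (y₂ - x₂) * c2
  · refine (mul_eq_zero.1 (?_ : v * D = 0)).resolve_right hD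
    rw [hDd]; linear_combination (y₁ - x₁) * c2 - (z₁ - x₁) * c1

/-- A convex body contains a convex body, arbitrarily close to a line segment, on which two given
integrals keep their signs. -/
lemma exists_nearly_one_dimensional {ι : Type*} [Fintype ι] [Nonempty ι] {F : Set (ι → ℝ)}
    (hFc : IsCompact F) (hFconv : Convex ℝ F) {φ ψ : (ι → ℝ) → ℝ}
    (hφ : IntegrableOn φ F) (hψ : IntegrableOn ψ F) (hφ0 : 0 < ∫ z in F, φ z)
    (hψ0 : 0 ≤ ∫ z in F, ψ z) {f : (ι → ℝ) → ℝ} (hf : Continuous f) {η : ℝ} (hη : 0 < η) :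
    ∃ (i : ι) (a e : ι → ℝ), ∃ G ⊆ F, IsCompact G ∧ Convex ℝ G ∧ 0 < (∫ z in G, φ z) ∧
      0 ≤ (∫ z in G, ψ z) ∧ ∀ z ∈ G, |f z - f (a + z i • e)| < η := by
  classical
  let X := {G : Set (ι → ℝ) // G ⊆ F ∧ IsCompact G ∧ Convex ℝ G ∧ 0 < (∫ z in G, φ z) ∧
    0 ≤ (∫ z in G, ψ z)}
  let T := (ι × ι) × (ℚ × ℚ)
  have step : ∀ (k : T) (G : X), ∃ G' : X, G'.1 ⊆ G.1 ∧ (k.1.1 ≠ k.1.2 →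
      ∃ θ : ℝ, G'.1 ⊆ coordHalfSpace k.1.1 k.1.2 k.2.1 k.2.2 θ) := by
    intro k G
    by_cases hk : k.1.1 = k.1.2
    · exact ⟨G, subset_rfl, fun h => absurd hk h⟩
    · obtain ⟨G', hG', h1, h2, h3, h4, h5⟩ := exists_bisection hk k.2.1 k.2.2 G.2.2.1 G.2.2.2.1
        (hφ.mono_set G.2.1) (hψ.mono_set G.2.1) G.2.2.2.2.1 G.2.2.2.2.2
      exact ⟨⟨G', hG'.trans G.2.1, h1, h2, h3, h4⟩, hG', fun _ => h5⟩
  choose S hS hS' using step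
  obtain ⟨enum, henum⟩ := exists_surjective_nat T
  let G : ℕ → X := fun n => Nat.rec ⟨F, subset_rfl, hFc, hFconv, hφ0, hψ0⟩
    (fun n g => S (enum n) g) n
  have hGs : ∀ n, G (n + 1) = S (enum n) (G n) := fun n => rfl
  have hanti : Antitone fun n => (G n).1 := antitone_nat_of_succ_le fun n => by
    rw [hGs]; exact hS _ _
  have hne : ∀ n, (G n).1.Nonempty := fun n => by
    by_contra h
    rw [Set.not_nonempty_iff_eq_empty] at h
    have := (G n).2.2.2.2.1
    rw [h] at this
    simp at this
  obtain ⟨x, hx⟩ : (⋂ n, (G n).1).Nonempty :=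
    IsCompact.nonempty_iInter_of_directed_nonempty_isCompact_isClosed _
      (directed_of_isDirected_le fun a b h => hanti h) hne (fun n => (G n).2.2.1)
      fun n => (G n).2.2.1.isClosed
  have hcol : ∀ y ∈ ⋂ n, (G n).1, ∀ z ∈ ⋂ n, (G n).1, ∀ i j,
      (y i - x i) * (z j - x j) - (y j - x j) * (z i - x i) = 0 := by
    intro y hy z hz i j
    by_cases hij : i = j
    · subst hij; ring
    by_contra hD
    obtain ⟨q, hq⟩ := exists_rat_interior_triangle _ _ _ _ _ _ hD
    obtain ⟨n, hn⟩ := henum ((i, j), q)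
    obtain ⟨θ, hθ⟩ := hS' (enum n) (G n) (by rw [hn]; exact hij)
    rw [← hGs, hn] at hθ
    have hmem := fun (y : ι → ℝ) (hy : y ∈ ⋂ n, (G n).1) => hθ (Set.mem_iInter.1 hy (n + 1))
    obtain ⟨h1, h2⟩ := hq (Real.cos θ) (Real.sin θ) (hmem x hx) (hmem y hy) (hmem z hz)
    have := Real.sin_sq_add_cos_sq θ
    rw [h1, h2] at this
    norm_num at this
  obtain ⟨i, a, e, hline⟩ : ∃ (i : ι) (a e : ι → ℝ), ∀ z ∈ ⋂ n, (G n).1, z = a + z i • e := by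
    by_cases hsing : ∀ y ∈ ⋂ n, (G n).1, y = x
    · exact ⟨Classical.arbitrary ι, x, 0, fun z hz => by simp [hsing z hz]⟩
    · push Not at hsing
      obtain ⟨y, hy, hyx⟩ := hsing
      obtain ⟨i, hi⟩ := Function.ne_iff.1 hyx
      have hi' : y i - x i ≠ 0 := sub_ne_zero.2 hi
      refine ⟨i, fun j => x j - x i * ((y j - x j) / (y i - x i)),
        fun j => (y j - x j) / (y i - x i), fun z hz => funext fun j => ?_⟩
      have := hcol y hy z hz i j
      simp only [Pi.add_apply, Pi.smul_apply, smul_eq_mul]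
      field_simp
      linarith
  have hopen : IsOpen {z : ι → ℝ | |f z - f (a + z i • e)| < η} :=
    isOpen_lt (by fun_prop) continuous_const
  obtain ⟨n, hn⟩ := exists_subset_nhds_of_isCompact (V := fun n => (G n).1)
    (directed_of_isDirected_le fun a b h => hanti h) (fun n => (G n).2.2.1)
    (U := {z : ι → ℝ | |f z - f (a + z i • e)| < η}) fun z hz => hopen.mem_nhds (by
      change |f z - f (a + z i • e)| < η
      rw [← hline z hz, sub_self, abs_zero]; exact hη)
  exact ⟨i, a, e, (G n).1, (G n).2.1, (G n).2.2.1, (G n).2.2.2.1, (G n).2.2.2.2.1,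
    (G n).2.2.2.2.2, hn⟩

lemma MvPolynomial.exists_polynomial_eval_line {ι : Type*} [Fintype ι]
    (P : MvPolynomial ι ℝ) (a e : ι → ℝ) :
    ∃ p : Polynomial ℝ, p.natDegree ≤ P.totalDegree ∧
      ∀ s : ℝ, p.eval s = MvPolynomial.eval (a + s • e) P := by
  refine ⟨MvPolynomial.aeval (fun j => Polynomial.C (a j) + Polynomial.C (e j) * Polynomial.X) P,
    ?_, fun s => ?_⟩
  · have := MvPolynomial.aeval_natDegree_le (m := P.totalDegree) (n := 1) P le_rfl
      (fun j => Polynomial.C (a j) + Polynomial.C (e j) * Polynomial.X) fun j => by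
        rw [add_comm]; exact Polynomial.natDegree_linear_le
    simpa using this
  · rw [← Polynomial.coe_evalRingHom, MvPolynomial.aeval_def, MvPolynomial.eval₂_eq',
      MvPolynomial.eval_eq', map_sum]
    refine Finset.sum_congr rfl fun x _ => ?_
    simp only [map_mul, map_prod, map_pow, map_add, Polynomial.coe_evalRingHom,
      Polynomial.eval_C, Polynomial.eval_X, Polynomial.algebraMap_eq, Pi.add_apply, Pi.smul_apply,
      smul_eq_mul, mul_comm s]

lemma exists_lt_measure_sublevel {X : Type*} [MeasurableSpace X] {μ : Measure X}
    [IsFiniteMeasure μ] {f : X → ℝ} {m κ : ℝ} (h : κ < μ.real {x | f x < m}) :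
    ∃ m' < m, κ < μ.real {x | f x < m'} := by
  have hmono : Monotone fun k : ℕ => {x | f x < m - 1 / ((k : ℝ) + 1)} := fun k k' hk x hx => by
    have h1 : f x < m - 1 / ((k : ℝ) + 1) := hx
    have h2 : 1 / ((k' : ℝ) + 1) ≤ 1 / ((k : ℝ) + 1) := Nat.one_div_le_one_div hk
    exact lt_of_lt_of_le h1 (by linarith)
  have hU : (⋃ k : ℕ, {x | f x < m - 1 / ((k : ℝ) + 1)}) = {x | f x < m} := by
    ext x
    simp only [Set.mem_iUnion]
    constructor
    · rintro ⟨k, hk⟩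
      have h1 : f x < m - 1 / ((k : ℝ) + 1) := hk
      have h2 : 0 < 1 / ((k : ℝ) + 1) := Nat.one_div_pos_of_nat
      exact lt_trans h1 (by linarith)
    · intro hx
      have hx' : f x < m := hx
      obtain ⟨k, hk⟩ := exists_nat_one_div_lt (sub_pos.2 hx')
      exact ⟨k, show f x < m - 1 / ((k : ℝ) + 1) by linarith⟩
  have ht := tendsto_measure_iUnion_atTop (μ := μ) hmono
  rw [hU] at ht
  have ht' := (ENNReal.tendsto_toReal (measure_ne_top μ _)).comp ht
  obtain ⟨k, hk⟩ := (ht'.eventually_const_lt h).exists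
  exact ⟨_, sub_lt_self m Nat.one_div_pos_of_nat, hk⟩

lemma setIntegral_indicator_sub_const {X : Type*} [MeasurableSpace X] {μ : Measure X} {F A : Set X}
    (hA : MeasurableSet A) (hF : μ F ≠ ⊤) (κ : ℝ) :
    IntegrableOn (fun z => A.indicator 1 z - κ) F μ ∧
      ∫ z in F, (A.indicator 1 z - κ) ∂μ = μ.real (F ∩ A) - κ * μ.real F := by
  have : IsFiniteMeasure (μ.restrict F) := ⟨by rw [Measure.restrict_apply_univ]; exact hF.lt_top⟩
  have hi : Integrable (A.indicator (1 : X → ℝ)) (μ.restrict F) :=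
    (integrable_const (1 : ℝ)).indicator hA
  refine ⟨hi.sub (integrable_const κ), ?_⟩
  rw [integral_sub hi (integrable_const κ), integral_indicator_one hA,
    measureReal_restrict_apply hA, Set.inter_comm, setIntegral_const, smul_eq_mul, mul_comm]

/-- The dilation inequality relating the two tails of a polynomial on a convex body. -/
lemma mul_volume_sublevel_le {ι : Type*} [Fintype ι] [Nonempty ι] {F : Set (ι → ℝ)}
    (hFc : IsCompact F) (hFconv : Convex ℝ F) (hF1 : volume F = 1) {d : ℕ}
    {P : MvPolynomial ι ℝ} (hP : P.totalDegree ≤ d) {l m : ℝ} (hl : 1 ≤ l)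
    (hK : 0 < volume.real {z ∈ F | (4 * l) ^ d * m ≤ |MvPolynomial.eval z P|}) :
    l * volume.real {z ∈ F | |MvPolynomial.eval z P| < m} ≤
      -Real.log (volume.real {z ∈ F | (4 * l) ^ d * m ≤ |MvPolynomial.eval z P|}) := by
  have hFm := hFc.measurableSet
  have hFt : volume F ≠ ⊤ := by simp [hF1]
  have hl0 : 0 < l := by linarith
  have hFr : volume.real F = 1 := by simp [measureReal_def, hF1]
  set f : (ι → ℝ) → ℝ := fun z => MvPolynomial.eval z P with hf
  have hfc : Continuous f := MvPolynomial.continuous_eval P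
  have hfm : Measurable fun z => |f z| := hfc.abs.measurable
  set c := (4 * l) ^ d with hc
  have hc1 : 1 ≤ c := one_le_pow₀ (by linarith)
  set K : Set (ι → ℝ) := {z | c * m ≤ |f z|} with hKd
  have hKm : MeasurableSet K := measurableSet_le measurable_const hfm
  change 0 < volume.real (F ∩ K) at hK
  set v := volume.real (F ∩ K) with hv
  change l * volume.real (F ∩ {z | |f z| < m}) ≤ -Real.log v
  by_contra! hcon
  have hv1 : v ≤ 1 := hFr ▸ measureReal_mono Set.inter_subset_left hFt
  have hlogv : 0 ≤ -Real.log v := neg_nonneg.2 (Real.log_nonpos hK.le hv1)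
  obtain ⟨κ, hκ1, hκ2⟩ := exists_between ((div_lt_iff₀' hl0).2 hcon)
  have hκ0 : 0 ≤ κ := (div_nonneg hlogv hl0.le).trans hκ1.le
  have : IsFiniteMeasure (volume.restrict F) :=
    ⟨by rw [Measure.restrict_apply_univ]; exact hFt.lt_top⟩
  have hres : ∀ m, (volume.restrict F).real {z | |f z| < m} =
      volume.real (F ∩ {z | |f z| < m}) := fun m => by
    rw [measureReal_restrict_apply (measurableSet_lt hfm measurable_const), Set.inter_comm]
  rw [← hres] at hκ2
  obtain ⟨m', hm', hκm'⟩ := exists_lt_measure_sublevel hκ2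
  rw [hres] at hκm'
  set A : Set (ι → ℝ) := {z | |f z| < m'} with hA
  have hAm : MeasurableSet A := measurableSet_lt hfm measurable_const
  have hm'0 : 0 < m' := by
    by_contra! h
    have : A = ∅ := Set.eq_empty_of_forall_notMem fun z hz =>
      (lt_of_lt_of_le (show |f z| < m' from hz) h).not_ge (abs_nonneg _)
    rw [this] at hκm'
    simp at hκm'
    linarith
  obtain ⟨hφi, hφ⟩ := setIntegral_indicator_sub_const hAm hFt κ
  obtain ⟨hψi, hψ⟩ := setIntegral_indicator_sub_const hKm hFt v
  obtain ⟨i, a, e, G, hGF, hGc, hGconv, hGφ, hGψ, hG⟩ := exists_nearly_one_dimensional hFc hFconv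
    hφi hψi (by rw [hφ, hFr]; linarith) (by rw [hψ, hFr]; linarith) hfc
    (η := (m - m') / 2) (by linarith)
  have hGt : volume G ≠ ⊤ := hGc.measure_lt_top.ne
  rw [(setIntegral_indicator_sub_const hAm hGt κ).2] at hGφ
  rw [(setIntegral_indicator_sub_const hKm hGt v).2] at hGψ
  have hG0 : volume G ≠ 0 := by
    intro h
    have h1 : volume.real G = 0 := by simp [measureReal_def, h]
    have h2 : volume.real (G ∩ A) ≤ volume.real G := measureReal_mono Set.inter_subset_left hGt
    rw [h1] at hGφ h2
    linarith
  have hGpos : 0 < volume.real G := ENNReal.toReal_pos hG0 hGt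
  obtain ⟨p, hpd, hp⟩ := MvPolynomial.exists_polynomial_eval_line P a e
  set m'' := m' + (m - m') / 2 with hm''
  have hclose : ∀ z ∈ G, |(|f z| - |p.eval (z i)|)| < (m - m') / 2 := fun z hz => by
    rw [hp]; exact (abs_abs_sub_abs_le _ _).trans_lt (hG z hz)
  have hAsub : G ∩ A ⊆ {z ∈ G | |p.eval (z i)| < m''} := fun z hz => ⟨hz.1, by
    have h1 := abs_lt.1 (hclose z hz.1)
    have h2 : |f z| < m' := hz.2
    linarith [h1.1]⟩
  have hKsub : G ∩ K ⊆ {z ∈ G | (4 * l) ^ d * m'' ≤ |p.eval (z i)|} := fun z hz => ⟨hz.1, by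
    have h1 := abs_lt.1 (hclose z hz.1)
    have h2 : c * m ≤ |f z| := hz.2
    rw [← hc]
    nlinarith [h1.2]⟩
  have hA' := measureReal_mono (μ := volume) hAsub
    (measure_ne_top_of_subset (fun z hz => hz.1) hGt)
  have hK' := measureReal_mono (μ := volume) hKsub
    (measure_ne_top_of_subset (fun z hz => hz.1) hGt)
  set vA := volume.real {z ∈ G | |p.eval (z i)| < m''} with hvA
  set vK := volume.real {z ∈ G | (4 * l) ^ d * m'' ≤ |p.eval (z i)|} with hvK
  have hvKpos : 0 < vK := lt_of_lt_of_le (by nlinarith [mul_pos hK hGpos]) hK'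
  have key := mul_volume_sublevel_coord_le i hGc hGconv hG0 (hpd.trans hP) hl
    (m := m'') (by rw [hm'']; linarith) (by
      intro h
      rw [hvK, measureReal_def, h] at hvKpos
      simp at hvKpos)
  change l * (vA / volume.real G) ≤ -Real.log (vK / volume.real G) at key
  have h1 : κ < vA / volume.real G := by
    rw [lt_div_iff₀ hGpos]; linarith
  have h2 : v ≤ vK / volume.real G := by
    rw [le_div_iff₀ hGpos]; linarith
  have h3 := Real.log_le_log hK h2
  rw [div_lt_iff₀ hl0] at hκ1
  nlinarith

lemma volume_real_sep_ofLp {n : ℕ} (F : Set (EuclideanSpace ℝ (Fin n)))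
    (p : (Fin n → ℝ) → Prop) :
    (volume {x ∈ F | p (fun i => x i)}).toReal =
      volume.real {z ∈ (WithLp.toLp 2 ⁻¹' F : Set (Fin n → ℝ)) | p z} := by
  rw [measureReal_def, ← (PiLp.volume_preserving_toLp (Fin n)).measure_preimage_emb
    (MeasurableEquiv.toLp 2 (Fin n → ℝ)).measurableEmbedding]
  rfl

/-- The product of the best constants in the two distribution inequalities is at most
the Remez constant `4`: `A₊ · A₋ ≤ 4`. -/
theorem best_constants_product {n : ℕ} (d : ℕ) (P : MvPolynomial (Fin n) ℝ)
    (hPd : P.totalDegree ≤ d) (hPnc : ∀ c : ℝ, P ≠ MvPolynomial.C c)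
    (F : Set (EuclideanSpace ℝ (Fin n))) (hFcomp : IsCompact F) (hFconv : Convex ℝ F)
    (hFvol : volume F = 1)
    (M : ℝ) (hM : 0 < M)
    (hMdef : volume {x ∈ F | M ≤ |MvPolynomial.eval (fun i => x i) P|} =
      ENNReal.ofReal (Real.exp (-1)))
    (Aplus Aminus : ℝ)
    (hAplus : Aplus = sInf {a : ℝ | 0 < a ∧ ∀ lam : ℝ, 1 ≤ lam →
      (volume {x ∈ F |
        (a * lam) ^ d * M ≤ |MvPolynomial.eval (fun i => x i) P|}).toReal ≤
          Real.exp (-lam)})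
    (hAminus : Aminus = sInf {a : ℝ | 0 < a ∧ ∀ lam : ℝ, 1 ≤ lam →
      (volume {x ∈ F |
        |MvPolynomial.eval (fun i => x i) P| < ((a * lam) ^ d)⁻¹ * M}).toReal ≤
          1 / lam}) :
    Aplus * Aminus ≤ 4 := by
  have : Nonempty (Fin n) := by
    by_contra h
    rw [not_nonempty_iff] at h
    exact hPnc _ (MvPolynomial.eq_C_of_isEmpty P)
  set G : Set (Fin n → ℝ) := WithLp.toLp 2 ⁻¹' F with hG
  have hGc : IsCompact G :=
    (EuclideanSpace.equiv (Fin n) ℝ).symm.toHomeomorph.isClosedEmbedding.isCompact_preimage hFcomp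
  have hGconv : Convex ℝ G :=
    hFconv.linear_preimage (EuclideanSpace.equiv (Fin n) ℝ).symm.toLinearMap
  have hG1 : volume G = 1 := by
    rw [hG, (PiLp.volume_preserving_toLp (Fin n)).measure_preimage_emb
      (MeasurableEquiv.toLp 2 (Fin n → ℝ)).measurableEmbedding, hFvol]
  have hAm0 : 0 ≤ Aminus := hAminus ▸ Real.sInf_nonneg fun a ha => ha.1.le
  have key : ∀ a, 0 < a → a < Aplus → a * Aminus ≤ 4 := by
    intro a ha haA
    have hna : a ∉ {a : ℝ | 0 < a ∧ ∀ lam : ℝ, 1 ≤ lam → (volume {x ∈ F |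
        (a * lam) ^ d * M ≤ |MvPolynomial.eval (fun i => x i) P|}).toReal ≤ Real.exp (-lam)} :=
      fun h => (hAplus ▸ haA).not_ge (csInf_le ⟨0, fun _ hx => hx.1.le⟩ h)
    simp only [Set.mem_ofPred_eq, not_and, not_forall, not_le] at hna
    obtain ⟨r, hr, hvol⟩ := hna ha
    have hr0 : 0 < r := by linarith
    rw [volume_real_sep_ofLp F fun z => (a * r) ^ d * M ≤ |MvPolynomial.eval z P|] at hvol
    suffices Aminus ≤ 4 / a by rwa [le_div_iff₀ ha, mul_comm] at this
    rw [hAminus]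
    refine csInf_le ⟨0, fun _ hx => hx.1.le⟩ ⟨by positivity, fun t ht => ?_⟩
    have ht0 : 0 < t := by linarith
    rw [volume_real_sep_ofLp F fun z => |MvPolynomial.eval z P| < ((4 / a * t) ^ d)⁻¹ * M]
    have e : (4 * (t * r)) ^ d * (((4 / a * t) ^ d)⁻¹ * M) = (a * r) ^ d * M := by
      rw [← mul_assoc, ← inv_pow, ← mul_pow]
      congr 2
      field_simp
    have h := mul_volume_sublevel_le hGc hGconv hG1 hPd (l := t * r)
      (m := ((4 / a * t) ^ d)⁻¹ * M) (one_le_mul_of_one_le_of_one_le ht hr)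
      (by rw [e]; exact (Real.exp_pos _).trans hvol)
    rw [e] at h
    have hlog := Real.log_lt_log (Real.exp_pos _) hvol
    rw [Real.log_exp] at hlog
    rw [le_div_iff₀ ht0]
    refine le_of_mul_le_mul_right ?_ hr0
    linarith
  by_contra! hlt
  have hAp : 0 < Aplus := by
    by_contra! h
    linarith [mul_nonpos_of_nonpos_of_nonneg h hAm0]
  have hAm : 0 < Aminus := by
    rcases hAm0.eq_or_lt with h | h
    · rw [← h, mul_zero] at hlt
      linarith
    · exact h
  have hq : 4 / Aminus < Aplus := (div_lt_iff₀ hAm).2 hlt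
  obtain ⟨a, h1, h2⟩ := exists_between hq
  exact (key a ((by positivity : 0 < 4 / Aminus).trans h1) h2).not_gt ((div_lt_iff₀ hAm).1 h1)
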